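/- Let T₁, T₂ be two actions of G on ℝ-trees whose minimal subtrees are dense, with C(T₁ × T₂) ≠ ∅. Then C(T₁ × T₂) is disconnected if and only if T₁ and T₂ are both refinements of a common non-trivial action of G on a simplicial tree T'. -/

import Mathlib

/-!
Formalization of definitions from V. Guirardel,
"Core and intersection number for group actions on trees".
-/

open Set Metric Filter Function Topology
open scoped ENNReal Pointwise

noncomputable section

namespace Guirardel

/-- The metric segment `[x,y]`: the set of points lying metrically between `x` and `y`.
In an `ℝ`-tree this is the image of the geodesic from `x` to `y`. -/
def seg {T : Type*} [MetricSpace T] (x y : T) : Set T :=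
  {p : T | dist x p + dist p y = dist x y}

/-- The open segment `]x,y[`. -/
def openSeg {T : Type*} [MetricSpace T] (x y : T) : Set T :=
  seg x y \ {x, y}

/-- A subset of an `ℝ`-tree is convex (i.e. a subtree when nonempty) if it contains the
segment between any two of its points. -/
def TreeConvex {T : Type*} [MetricSpace T] (S : Set T) : Prop :=
  ∀ x ∈ S, ∀ y ∈ S, seg x y ⊆ S

/-- An `ℝ`-tree: any two points are joined by a geodesic, and any two injective paths
with the same endpoints have the same image (uniqueness of arcs). -/
structure IsRTree (T : Type*) [MetricSpace T] : Prop where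
  exists_geod : ∀ x y : T, ∃ f : ℝ → T, f 0 = x ∧ f (dist x y) = y ∧
    ∀ s ∈ Icc (0 : ℝ) (dist x y), ∀ t ∈ Icc (0 : ℝ) (dist x y),
      dist (f s) (f t) = |s - t|
  arc_unique : ∀ (x y : T) (γ₁ γ₂ : Path x y),
    Function.Injective γ₁ → Function.Injective γ₂ →
      Set.range γ₁ = Set.range γ₂

/-- A direction based at `x`: a connected component of the complement of `x`. -/
def IsDirectionAt {T : Type*} [MetricSpace T] (δ : Set T) (x : T) : Prop :=
  ∃ y : T, y ≠ x ∧ δ = connectedComponentIn {x}ᶜ y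

/-- A direction in a tree. -/
def IsDirection {T : Type*} [MetricSpace T] (δ : Set T) : Prop :=
  ∃ x : T, IsDirectionAt δ x

/-- A branch point: a point with at least three directions. -/
def IsBranchPoint {T : Type*} [MetricSpace T] (x : T) : Prop :=
  ∃ δ₁ δ₂ δ₃ : Set T, IsDirectionAt δ₁ x ∧ IsDirectionAt δ₂ x ∧ IsDirectionAt δ₃ x ∧
    δ₁ ≠ δ₂ ∧ δ₁ ≠ δ₃ ∧ δ₂ ≠ δ₃

/-- A quadrant in `T₁ × T₂`: a product of two directions. -/
def IsQuadrant {T₁ T₂ : Type*} [MetricSpace T₁] [MetricSpace T₂]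
    (Q : Set (T₁ × T₂)) : Prop :=
  ∃ (δ₁ : Set T₁) (δ₂ : Set T₂), IsDirection δ₁ ∧ IsDirection δ₂ ∧ Q = δ₁ ×ˢ δ₂

/-- A quadrant is heavy if (for every choice of base point, which does not matter) there
is a sequence of orbit points inside it whose two coordinates go to infinity. -/
def Heavy (G : Type*) {T₁ T₂ : Type*} [Group G] [MetricSpace T₁] [MetricSpace T₂]
    [MulAction G T₁] [MulAction G T₂] (Q : Set (T₁ × T₂)) : Prop :=
  ∀ p : T₁ × T₂, ∃ γ : ℕ → G,
    (∀ k, ((γ k • p.1 : T₁), (γ k • p.2 : T₂)) ∈ Q) ∧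
    Tendsto (fun k => dist (γ k • p.1) p.1) atTop atTop ∧
    Tendsto (fun k => dist (γ k • p.2) p.2) atTop atTop

/-- The core of `T₁ × T₂`: the complement of the union of all light (i.e. non-heavy)
quadrants; equivalently the set of points all of whose quadrants are heavy. -/
def Core (G T₁ T₂ : Type*) [Group G] [MetricSpace T₁] [MetricSpace T₂]
    [MulAction G T₁] [MulAction G T₂] : Set (T₁ × T₂) :=
  {z : T₁ × T₂ | ∀ Q : Set (T₁ × T₂), IsQuadrant Q → z ∈ Q → Heavy G Q}

/-- A subset of `T₁ × T₂` has convex fibers if its horizontal and vertical fibers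
are convex. -/
def ConvexFibers {T₁ T₂ : Type*} [MetricSpace T₁] [MetricSpace T₂]
    (E : Set (T₁ × T₂)) : Prop :=
  (∀ x₁ : T₁, TreeConvex {y₂ : T₂ | (x₁, y₂) ∈ E}) ∧
  (∀ x₂ : T₂, TreeConvex {y₁ : T₁ | (y₁, x₂) ∈ E})

/-- The action of `G` on `T` is by isometries. -/
def IsometricAction (G T : Type*) [MetricSpace T] [SMul G T] : Prop :=
  ∀ (g : G) (x y : T), dist (g • x) (g • y) = dist x y

/-- `g` is elliptic: it fixes a point of `T`. -/
def Elliptic {G : Type*} (T : Type*) [SMul G T] (g : G) : Prop :=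
  ∃ x : T, g • x = x

/-- `g` is hyperbolic: it fixes no point of `T`. -/
def Hyperbolic {G : Type*} (T : Type*) [SMul G T] (g : G) : Prop :=
  ∀ x : T, g • x ≠ x

/-- Translation length of `g` on `T`. -/
def translationLength {G : Type*} (T : Type*) [MetricSpace T] [SMul G T] (g : G) : ℝ :=
  ⨅ x : T, dist x (g • x)

/-- The axis (characteristic set) of `g`: points minimizing displacement. -/
def axisSet {G : Type*} (T : Type*) [MetricSpace T] [SMul G T] (g : G) : Set T :=
  {x : T | ∀ y : T, dist x (g • x) ≤ dist y (g • y)}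

/-- The action is non-trivial: some element is hyperbolic. -/
def NontrivialAction (G T : Type*) [SMul G T] : Prop :=
  ∃ g : G, ∀ x : T, g • x ≠ x

/-- The action is free: only the identity fixes a point. -/
def FreeAction (G T : Type*) [Group G] [MulAction G T] : Prop :=
  ∀ g : G, g ≠ 1 → ∀ x : T, g • x ≠ x

/-- The action is minimal: no proper nonempty invariant subtree. -/
def MinimalAction (G T : Type*) [MetricSpace T] [SMul G T] : Prop :=
  ∀ S : Set T, S.Nonempty → TreeConvex S → (∀ g : G, ∀ x ∈ S, g • x ∈ S) → S = univ

/-- The minimal subtree for the subset `H` of `G`: the intersection of all nonempty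
invariant subtrees. -/
def minSubtreeOf {G : Type*} (H : Set G) (T : Type*) [MetricSpace T] [SMul G T] : Set T :=
  ⋂₀ {S : Set T | S.Nonempty ∧ TreeConvex S ∧ ∀ g ∈ H, ∀ x ∈ S, g • x ∈ S}

/-- The minimal subtree of the `G`-action. -/
def minSubtree (G T : Type*) [MetricSpace T] [SMul G T] : Set T :=
  minSubtreeOf (univ : Set G) T

/-- A line in `T`: the image of an isometric embedding of `ℝ`. -/
def IsLine {T : Type*} [MetricSpace T] (L : Set T) : Prop :=
  ∃ f : ℝ → T, (∀ s t : ℝ, dist (f s) (f t) = |s - t|) ∧ L = range f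

/-- A ray in `T`: the image of an isometric embedding of `[0,∞)`. -/
def IsRay {T : Type*} [MetricSpace T] (R : Set T) : Prop :=
  ∃ f : ℝ → T, (∀ s ∈ Ici (0 : ℝ), ∀ t ∈ Ici (0 : ℝ), dist (f s) (f t) = |s - t|) ∧
    R = f '' Ici 0

/-- Two rays (or subsets) define the same end when they are at finite Hausdorff distance. -/
def SameEnd {T : Type*} [MetricSpace T] (R R' : Set T) : Prop :=
  EMetric.hausdorffEdist R R' ≠ ⊤

/-- The action of `G` fixes an end of `T`. -/
def GFixedEnd (G T : Type*) [MetricSpace T] [SMul G T] : Prop :=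
  ∃ R : Set T, IsRay R ∧ ∀ g : G, SameEnd ((fun x => g • x) '' R) R

/-- The action of `G` has an invariant line. -/
def GInvariantLine (G T : Type*) [MetricSpace T] [SMul G T] : Prop :=
  ∃ L : Set T, IsLine L ∧ ∀ g : G, (fun x => g • x) '' L = L

/-- The action is irreducible: no invariant line and no fixed end. -/
def IrreducibleAction (G T : Type*) [MetricSpace T] [SMul G T] : Prop :=
  ¬ GInvariantLine G T ∧ ¬ GFixedEnd G T

/-- The action is dihedral: there is an invariant line on which some element acts as a
reflection (i.e. with non-constant displacement along the line). -/
def DihedralAction (G T : Type*) [MetricSpace T] [SMul G T] : Prop :=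
  ∃ L : Set T, IsLine L ∧ (∀ g : G, (fun x => g • x) '' L = L) ∧
    ∃ g : G, ∃ x ∈ L, ∃ y ∈ L, dist x (g • x) ≠ dist y (g • y)

/-- `A` is a positive semi-axis of `g`: a ray contained in the axis of `g` and mapped
into itself by `g`. -/
def PosSemiAxis {G : Type*} (T : Type*) [MetricSpace T] [SMul G T] (g : G) (A : Set T) :
    Prop :=
  IsRay A ∧ A ⊆ axisSet T g ∧ (fun x => g • x) '' A ⊆ A

/-- `g` translates towards the end determined by the ray `R`:
`g` is hyperbolic and has a positive semi-axis defining the same end as `R`. -/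
def TranslatesToward {G : Type*} (T : Type*) [MetricSpace T] [SMul G T] (g : G)
    (R : Set T) : Prop :=
  Hyperbolic T g ∧ ∃ A : Set T, PosSemiAxis T g A ∧ SameEnd A R

/-- The end `ω_T(g)` of the hyperbolic element `g` lies in the set of ends of `δ`:
some positive semi-axis of `g` is contained in `δ`. -/
def EndInSubtree {G : Type*} (T : Type*) [MetricSpace T] [SMul G T] (g : G)
    (δ : Set T) : Prop :=
  ∃ A : Set T, PosSemiAxis T g A ∧ A ⊆ δ

/-- A map between `ℝ`-trees preserves alignment if the image of a point between `y`
and `z` lies between the images of `y` and `z`. -/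
def AlignPreserving {T T' : Type*} [MetricSpace T] [MetricSpace T'] (f : T → T') : Prop :=
  ∀ x y z : T, x ∈ seg y z → f x ∈ seg (f y) (f z)

/-- `f : T → T'` witnesses that `T` is a refinement of `T'`: it is an equivariant
continuous surjection preserving alignment. -/
def IsRefinementMap (G : Type*) {T T' : Type*} [Group G] [MetricSpace T] [MetricSpace T']
    [MulAction G T] [MulAction G T'] (f : T → T') : Prop :=
  Continuous f ∧ Surjective f ∧ AlignPreserving f ∧ ∀ (g : G) (x : T), f (g • x) = g • f x

/-- The length functions of the two actions are homothetic. -/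
def HomotheticLengths (G T₁ T₂ : Type*) [MetricSpace T₁] [MetricSpace T₂] [SMul G T₁]
    [SMul G T₂] : Prop :=
  ∃ c : ℝ, 0 < c ∧ ∀ g : G, translationLength T₁ g = c * translationLength T₂ g

/-- A bundled `ℝ`-tree with an isometric action of `G`. -/
structure GTree (G : Type*) [Group G] where
  carrier : Type
  [ms : MetricSpace carrier]
  [ma : MulAction G carrier]
  isom : ∀ (g : G) (x y : carrier), dist (g • x) (g • y) = dist x y
  tree : IsRTree carrier

attribute [instance] GTree.ms GTree.ma

/-- A simplicial structure on an `ℝ`-tree: a vertex set containing all branch points,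
meeting every segment in a finite set, and discrete. -/
def IsSimplicialStructure {T : Type*} [MetricSpace T] (V : Set T) : Prop :=
  (∀ x : T, IsBranchPoint x → x ∈ V) ∧
  (∀ x y : T, (seg x y ∩ V).Finite) ∧
  (∀ v ∈ V, ∃ ε > 0, ∀ w ∈ V, dist v w < ε → w = v)

/-- Two vertices of a simplicial tree are adjacent (span an edge). -/
def Adjacent {T : Type*} [MetricSpace T] (V : Set T) (v w : T) : Prop :=
  v ∈ V ∧ w ∈ V ∧ v ≠ w ∧ seg v w ∩ V = {v, w}

/-- A bundled simplicial `G`-tree. -/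
structure SimplicialGTree (G : Type*) [Group G] extends GTree G where
  V : Set carrier
  simp : IsSimplicialStructure V
  inv : ∀ g : G, (fun x => g • x) '' V = V

/-- `T₁` and `T₂` are refinements of a common non-trivial simplicial action of `G`. -/
def RefineCommonSimplicial (G T₁ T₂ : Type*) [Group G] [MetricSpace T₁] [MetricSpace T₂]
    [MulAction G T₁] [MulAction G T₂] : Prop :=
  ∃ T' : SimplicialGTree G, NontrivialAction G T'.carrier ∧
    (∃ f₁ : T₁ → T'.carrier, IsRefinementMap G f₁) ∧
    (∃ f₂ : T₂ → T'.carrier, IsRefinementMap G f₂)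

/-- Two directions face each other: their union is the whole tree. -/
def FacingDirections {T : Type*} [MetricSpace T] (δ δ' : Set T) : Prop :=
  δ ∪ δ' = univ

/-- There is a twice-light rectangle with (opposite) base corners `x` and `x'`:
two light quadrants based at `x` and `x'` facing each other. -/
def IsTwiceLightRect (G : Type*) {T₁ T₂ : Type*} [Group G] [MetricSpace T₁]
    [MetricSpace T₂] [MulAction G T₁] [MulAction G T₂] (x x' : T₁ × T₂) : Prop :=
  ∃ (δ₁ : Set T₁) (δ₂ : Set T₂) (δ₁' : Set T₁) (δ₂' : Set T₂),
    IsDirectionAt δ₁ x.1 ∧ IsDirectionAt δ₂ x.2 ∧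
    IsDirectionAt δ₁' x'.1 ∧ IsDirectionAt δ₂' x'.2 ∧
    x.1 ≠ x'.1 ∧ x.2 ≠ x'.2 ∧
    FacingDirections δ₁ δ₁' ∧ FacingDirections δ₂ δ₂' ∧
    ¬ Heavy G (δ₁ ×ˢ δ₂) ∧ ¬ Heavy G (δ₁' ×ˢ δ₂')

/-- The open rectangle with opposite corners `x, x'`. -/
def openRect {T₁ T₂ : Type*} [MetricSpace T₁] [MetricSpace T₂] (x x' : T₁ × T₂) :
    Set (T₁ × T₂) :=
  openSeg x.1 x'.1 ×ˢ openSeg x.2 x'.2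

/-- A maximal twice-light rectangle. -/
def IsMaxTwiceLightRect (G : Type*) {T₁ T₂ : Type*} [Group G] [MetricSpace T₁]
    [MetricSpace T₂] [MulAction G T₁] [MulAction G T₂] (x x' : T₁ × T₂) : Prop :=
  IsTwiceLightRect G x x' ∧ ∀ y y' : T₁ × T₂, IsTwiceLightRect G y y' →
    openRect x x' ⊆ openRect y y' → openRect x x' = openRect y y'

/-- The straight diagonal of a rectangle joining the two opposite corners `p` and `q`. -/
def mainDiag {T₁ T₂ : Type*} [MetricSpace T₁] [MetricSpace T₂] (p q : T₁ × T₂) :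
    Set (T₁ × T₂) :=
  {z : T₁ × T₂ | z.1 ∈ seg p.1 q.1 ∧ z.2 ∈ seg p.2 q.2 ∧
    dist p.1 z.1 * dist p.2 q.2 = dist p.2 z.2 * dist p.1 q.1}

/-- The augmented core: the union of the core and of the main diagonals of the maximal
twice-light rectangles (the diagonals joining the two opposite corners lying in the core). -/
def AugCore (G T₁ T₂ : Type*) [Group G] [MetricSpace T₁] [MetricSpace T₂]
    [MulAction G T₁] [MulAction G T₂] : Set (T₁ × T₂) :=
  Core G T₁ T₂ ∪
    {z : T₁ × T₂ | ∃ x x' p q : T₁ × T₂, IsMaxTwiceLightRect G x x' ∧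
      p ∈ Core G T₁ T₂ ∧ q ∈ Core G T₁ T₂ ∧
      ({p.1, q.1} : Set T₁) = {x.1, x'.1} ∧ ({p.2, q.2} : Set T₂) = {x.2, x'.2} ∧
      p.1 ≠ q.1 ∧ p.2 ≠ q.2 ∧ z ∈ mainDiag p q}

/-- There exists an equivariant (strong) deformation retraction of `T₁ × T₂` onto `C`. -/
def EquivDeformRetract (G : Type*) {T₁ T₂ : Type*} [Group G] [MetricSpace T₁]
    [MetricSpace T₂] [MulAction G T₁] [MulAction G T₂] (C : Set (T₁ × T₂)) : Prop :=
  ∃ H : ℝ → T₁ × T₂ → T₁ × T₂,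
    Continuous (fun p : ℝ × (T₁ × T₂) => H p.1 p.2) ∧
    (∀ z : T₁ × T₂, H 0 z = z) ∧
    (∀ z : T₁ × T₂, H 1 z ∈ C) ∧
    (∀ t : ℝ, ∀ z ∈ C, H t z = z) ∧
    (∀ (t : ℝ) (g : G) (z : T₁ × T₂), H t (g • z) = g • H t z)

/-- The `ℓ²` product distance on `T₁ × T₂`. -/
def dist2 {T₁ T₂ : Type*} [MetricSpace T₁] [MetricSpace T₂] (p q : T₁ × T₂) : ℝ :=
  Real.sqrt (dist p.1 q.1 ^ 2 + dist p.2 q.2 ^ 2)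

/-- The length of a path `c : [0,1] → T₁ × T₂`, measured with the `ℓ²` product metric. -/
def pathLen2 {T₁ T₂ : Type*} [MetricSpace T₁] [MetricSpace T₂] (c : ℝ → T₁ × T₂) :
    ℝ≥0∞ :=
  ⨆ (n : ℕ) (u : Fin (n + 1) → ℝ) (_ : Monotone u) (_ : ∀ i, u i ∈ Icc (0 : ℝ) 1),
    ∑ i : Fin n, ENNReal.ofReal (dist2 (c (u i.castSucc)) (c (u i.succ)))

/-- The path metric induced on a subset `C ⊆ T₁ × T₂` by the `ℓ²` product metric. -/
def pathDistOn {T₁ T₂ : Type*} [MetricSpace T₁] [MetricSpace T₂] (C : Set (T₁ × T₂))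
    (x y : C) : ℝ :=
  (⨅ (c : ℝ → T₁ × T₂) (_ : ContinuousOn c (Icc (0 : ℝ) 1))
      (_ : MapsTo c (Icc (0 : ℝ) 1) C) (_ : c 0 = (x : T₁ × T₂))
      (_ : c 1 = (y : T₁ × T₂)), pathLen2 c).toReal

/-- A distance function makes a set a CAT(0) space: it is a metric, geodesic, and the
CN-inequality of Bruhat–Tits holds (comparison triangles are at least as thick). -/
structure IsCAT0Dist {X : Type*} (d : X → X → ℝ) : Prop where
  refl : ∀ x, d x x = 0
  symm : ∀ x y, d x y = d y x
  triangle : ∀ x y z, d x z ≤ d x y + d y z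
  eq_of_dist_eq_zero : ∀ x y, d x y = 0 → x = y
  geodesic : ∀ x y, ∃ f : ℝ → X, f 0 = x ∧ f (d x y) = y ∧
    ∀ s ∈ Icc (0 : ℝ) (d x y), ∀ t ∈ Icc (0 : ℝ) (d x y), d (f s) (f t) = |s - t|
  cn : ∀ x y z m, d y m = d y z / 2 → d m z = d y z / 2 →
    d x m ^ 2 ≤ (d x y ^ 2 + d x z ^ 2) / 2 - d y z ^ 2 / 4

/-- A 2-cell of the core of a product of two simplicial trees: a rectangle which is a
product of two edges and is contained in the core. -/
def IsCoreCell (G : Type*) {T₁ T₂ : Type*} [Group G] [MetricSpace T₁] [MetricSpace T₂]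
    [MulAction G T₁] [MulAction G T₂] (V₁ : Set T₁) (V₂ : Set T₂)
    (R : Set (T₁ × T₂)) : Prop :=
  ∃ v₁ w₁ v₂ w₂, Adjacent V₁ v₁ w₁ ∧ Adjacent V₂ v₂ w₂ ∧
    R = seg v₁ w₁ ×ˢ seg v₂ w₂ ∧ R ⊆ Core G T₁ T₂

/-- A geodesic metric space satisfying the four-point condition; equivalent to `IsRTree`. -/
structure TreeLike (T : Type*) [MetricSpace T] : Prop where
  exists_geod : ∀ x y : T, ∃ f : ℝ → T, f 0 = x ∧ f (dist x y) = y ∧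
    ∀ s ∈ Icc (0 : ℝ) (dist x y), ∀ t ∈ Icc (0 : ℝ) (dist x y),
      dist (f s) (f t) = |s - t|
  four_point : ∀ x y z w : T,
    dist x y + dist z w ≤ dist x z + dist y w ∨ dist x y + dist z w ≤ dist x w + dist y z

section RTreeToTreeLike

variable {T : Type*} [MetricSpace T]

lemma mem_seg {x y p : T} : p ∈ seg x y ↔ dist x p + dist p y = dist x y := Iff.rfl

/-- The path obtained by rescaling a curve parametrised by `[0, L]`. -/
def pathOfCurve {x y : T} (k : ℝ → T) (L : ℝ) (hL : 0 ≤ L) (hc : ContinuousOn k (Icc 0 L))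
    (h0 : k 0 = x) (h1 : k L = y) : Path x y where
  toFun t := k (L * t)
  continuous_toFun := by
    refine hc.comp_continuous (by fun_prop) fun t => ⟨mul_nonneg hL t.2.1, ?_⟩
    exact mul_le_of_le_one_right hL t.2.2
  source' := by simpa using h0
  target' := by simpa using h1

lemma range_pathOfCurve {x y : T} (k : ℝ → T) (L : ℝ) (hL : 0 < L)
    (hc : ContinuousOn k (Icc 0 L)) (h0 : k 0 = x) (h1 : k L = y) :
    range (pathOfCurve k L hL.le hc h0 h1) = k '' Icc 0 L := by
  ext p
  constructor
  · rintro ⟨t, rfl⟩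
    exact ⟨L * t, ⟨mul_nonneg hL.le t.2.1, mul_le_of_le_one_right hL.le t.2.2⟩, rfl⟩
  · rintro ⟨s, hs, rfl⟩
    refine ⟨⟨s / L, div_nonneg hs.1 hL.le, div_le_one_of_le₀ hs.2 hL.le⟩, ?_⟩
    change k (L * (s / L)) = k s
    rw [mul_div_cancel₀ _ hL.ne']

lemma IsRTree.image_eq (hT : IsRTree T) {x y : T} {k k' : ℝ → T} {L L' : ℝ} (hL : 0 < L)
    (hL' : 0 < L') (hc : ContinuousOn k (Icc 0 L)) (hc' : ContinuousOn k' (Icc 0 L'))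
    (hi : InjOn k (Icc 0 L)) (hi' : InjOn k' (Icc 0 L'))
    (h0 : k 0 = x) (h1 : k L = y) (h0' : k' 0 = x) (h1' : k' L' = y) :
    k '' Icc 0 L = k' '' Icc 0 L' := by
  have inj : ∀ (k : ℝ → T) (L : ℝ) (hL : 0 < L) (hc : ContinuousOn k (Icc 0 L))
      (h0 : k 0 = x) (h1 : k L = y), InjOn k (Icc 0 L) →
      Injective (pathOfCurve k L hL.le hc h0 h1) := by
    intro k L hL hc h0 h1 hi s t hst
    have := hi ⟨mul_nonneg hL.le s.2.1, mul_le_of_le_one_right hL.le s.2.2⟩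
      ⟨mul_nonneg hL.le t.2.1, mul_le_of_le_one_right hL.le t.2.2⟩ hst
    exact Subtype.ext (mul_left_cancel₀ hL.ne' this)
  rw [← range_pathOfCurve k L hL hc h0 h1, ← range_pathOfCurve k' L' hL' hc' h0' h1']
  exact hT.arc_unique x y _ _ (inj k L hL hc h0 h1 hi) (inj k' L' hL' hc' h0' h1' hi')

lemma continuousOn_of_dist_eq {k : ℝ → T} {s : Set ℝ}
    (hk : ∀ a ∈ s, ∀ b ∈ s, dist (k a) (k b) = |a - b|) : ContinuousOn k s := by
  have : LipschitzOnWith 1 k s := LipschitzOnWith.of_dist_le_mul fun a ha b hb => by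
    rw [hk a ha b hb, Real.dist_eq]; simp
  exact this.continuousOn

lemma injOn_of_dist_eq {k : ℝ → T} {s : Set ℝ}
    (hk : ∀ a ∈ s, ∀ b ∈ s, dist (k a) (k b) = |a - b|) : InjOn k s := by
  intro a ha b hb hab
  have := hk a ha b hb
  rw [hab, dist_self] at this
  linarith [abs_eq_zero.mp this.symm]

/-- If the geodesics from `x` to `y` and from `x` to `z` only share points up to time `s`,
then their branching point lies between `y` and `z`. -/
lemma IsRTree.mem_seg_of_branch (hT : IsRTree T) {x y z : T} {c₁ c₂ : ℝ → T} {s : ℝ}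
    (hs : 0 ≤ s) (hsy : s ≤ dist x y) (hsz : s ≤ dist x z)
    (h10 : c₁ 0 = x) (h11 : c₁ (dist x y) = y) (h20 : c₂ 0 = x) (h21 : c₂ (dist x z) = z)
    (h1 : ∀ a ∈ Icc (0 : ℝ) (dist x y), ∀ b ∈ Icc (0 : ℝ) (dist x y),
      dist (c₁ a) (c₁ b) = |a - b|)
    (h2 : ∀ a ∈ Icc (0 : ℝ) (dist x z), ∀ b ∈ Icc (0 : ℝ) (dist x z),
      dist (c₂ a) (c₂ b) = |a - b|)
    (hm : c₁ s = c₂ s)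
    (hmax : ∀ t, s < t → t ≤ dist x y → t ≤ dist x z → c₁ t ≠ c₂ t) :
    c₁ s ∈ seg y z := by
  have hx1 : ∀ a ∈ Icc (0 : ℝ) (dist x y), dist x (c₁ a) = a := by
    intro a ha
    have := h1 0 ⟨le_rfl, dist_nonneg⟩ a ha
    rw [h10] at this
    rw [this, zero_sub, abs_neg, abs_of_nonneg ha.1]
  have hx2 : ∀ a ∈ Icc (0 : ℝ) (dist x z), dist x (c₂ a) = a := by
    intro a ha
    have := h2 0 ⟨le_rfl, dist_nonneg⟩ a ha
    rw [h20] at this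
    rw [this, zero_sub, abs_neg, abs_of_nonneg ha.1]
  by_cases hyz : y = z
  · subst hyz
    have : s = dist x y := by
      by_contra hne
      exact hmax (dist x y) (lt_of_le_of_ne hsy hne) le_rfl le_rfl (h11.trans h21.symm)
    rw [this, h11]
    simp [seg]
  set A := dist x y - s with hA
  set B := dist x z - s with hB
  have hA0 : 0 ≤ A := by linarith
  have hB0 : 0 ≤ B := by linarith
  let k : ℝ → T := fun t => if t ≤ A then c₁ (dist x y - t) else c₂ (s + (t - A))
  have hk1 : ∀ t ≤ A, k t = c₁ (dist x y - t) := fun t ht => if_pos ht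
  have hk2 : ∀ t, A ≤ t → k t = c₂ (s + (t - A)) := by
    intro t ht
    rcases ht.eq_or_lt with rfl | ht
    · rw [hk1 _ le_rfl, sub_self, add_zero, ← hm, hA, sub_sub_cancel]
    · exact if_neg (not_le.mpr ht)
  have hlen : 0 < A + B := by
    rcases hA0.eq_or_lt with h | h
    · rcases hB0.eq_or_lt with h' | h'
      · exfalso
        apply hyz
        rw [← h11, ← h21, show dist x y = s by linarith, show dist x z = s by linarith, hm]
      · linarith
    · linarith
  have hk0 : k 0 = y := by rw [hk1 _ hA0, sub_zero, h11]
  have hkL : k (A + B) = z := by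
    rw [hk2 _ (by linarith), show s + (A + B - A) = dist x z by linarith, h21]
  have hcont : ContinuousOn k (Icc 0 (A + B)) := by
    have e : Icc 0 (A + B) = Icc 0 A ∪ Icc A (A + B) :=
      (Icc_union_Icc_eq_Icc hA0 (by linarith)).symm
    rw [e]
    apply ContinuousOn.union_of_isClosed _ _ isClosed_Icc isClosed_Icc
    · have : ContinuousOn (fun t => c₁ (dist x y - t)) (Icc 0 A) :=
        (continuousOn_of_dist_eq h1).comp (by fun_prop) fun t ht =>
          ⟨by linarith [ht.2], by linarith [ht.1]⟩
      exact this.congr fun t ht => hk1 t ht.2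
    · have : ContinuousOn (fun t => c₂ (s + (t - A))) (Icc A (A + B)) :=
        (continuousOn_of_dist_eq h2).comp (by fun_prop) fun t ht =>
          ⟨by linarith [ht.1], by linarith [ht.2]⟩
      exact this.congr fun t ht => hk2 t ht.1
  have hinj : InjOn k (Icc 0 (A + B)) := by
    have cross : ∀ t ∈ Icc 0 (A + B), ∀ t' ∈ Icc 0 (A + B), t ≤ A → A < t' → k t ≠ k t' := by
      intro t ht t' ht' h h' heq
      rw [hk1 t h, hk2 t' h'.le] at heq
      have e1 := hx1 (dist x y - t) ⟨by linarith, by linarith [ht.1]⟩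
      have e2 := hx2 (s + (t' - A)) ⟨by linarith, by linarith [ht'.2]⟩
      rw [heq, e2] at e1
      rw [← e1] at heq
      exact hmax _ (by linarith) (by linarith [ht.1]) (by linarith [ht'.2]) heq
    intro t ht t' ht' heq
    rcases le_or_gt t A with h | h <;> rcases le_or_gt t' A with h' | h'
    · rw [hk1 t h, hk1 t' h'] at heq
      have := injOn_of_dist_eq h1 ⟨by linarith, by linarith [ht.1]⟩
        ⟨by linarith, by linarith [ht'.1]⟩ heq
      linarith
    · exact absurd heq (cross t ht t' ht' h h')
    · exact absurd heq.symm (cross t' ht' t ht h' h)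
    · rw [hk2 t h.le, hk2 t' h'.le] at heq
      have := injOn_of_dist_eq h2 ⟨by linarith, by linarith [ht.2]⟩
        ⟨by linarith, by linarith [ht'.2]⟩ heq
      linarith
  obtain ⟨c, hc0, hc1, hc⟩ := hT.exists_geod y z
  have himg := hT.image_eq hlen (dist_pos.mpr hyz) hcont (continuousOn_of_dist_eq hc) hinj
    (injOn_of_dist_eq hc) hk0 hkL hc0 hc1
  have hmem : c₁ s ∈ k '' Icc 0 (A + B) :=
    ⟨A, ⟨hA0, by linarith⟩, by rw [hk1 A le_rfl, hA, sub_sub_cancel]⟩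
  rw [himg] at hmem
  obtain ⟨t, ht, hts⟩ := hmem
  rw [← hts, mem_seg]
  have e1 := hc 0 ⟨le_rfl, dist_nonneg⟩ t ht
  have e2 := hc t ht (dist y z) ⟨dist_nonneg, le_rfl⟩
  rw [hc0] at e1
  rw [hc1] at e2
  rw [e1, e2, zero_sub, abs_neg, abs_of_nonneg ht.1, abs_of_nonpos (by linarith [ht.2])]
  ring

/-- The branching time of two curves issued from the same point. -/
lemma exists_max_agree {c₁ c₂ : ℝ → T} {a b : ℝ} (ha : 0 ≤ a) (hb : 0 ≤ b)
    (h1 : ContinuousOn c₁ (Icc 0 a)) (h2 : ContinuousOn c₂ (Icc 0 b)) (h0 : c₁ 0 = c₂ 0) :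
    ∃ s, 0 ≤ s ∧ s ≤ a ∧ s ≤ b ∧ c₁ s = c₂ s ∧
      ∀ t, s < t → t ≤ a → t ≤ b → c₁ t ≠ c₂ t := by
  set m := min a b with hm
  have hK : IsCompact {t ∈ Icc 0 m | c₁ t = c₂ t} := by
    apply isCompact_Icc.of_isClosed_subset _ (sep_subset _ _)
    have h1' : ContinuousOn c₁ (Icc 0 m) := h1.mono (Icc_subset_Icc_right (min_le_left _ _))
    have h2' : ContinuousOn c₂ (Icc 0 m) := h2.mono (Icc_subset_Icc_right (min_le_right _ _))
    have := (h1'.prodMk h2').preimage_isClosed_of_isClosed isClosed_Icc isClosed_diagonal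
    exact this
  obtain ⟨s, hs, hmax⟩ := hK.exists_isGreatest ⟨0, ⟨le_rfl, le_min ha hb⟩, h0⟩
  refine ⟨s, hs.1.1, hs.1.2.trans (min_le_left _ _), hs.1.2.trans (min_le_right _ _), hs.2, ?_⟩
  intro t hst hta htb heq
  exact absurd (hmax ⟨⟨hs.1.1.trans hst.le, le_min hta htb⟩, heq⟩) (not_le.mpr hst)

lemma dist_zero_geod {x y : T} {c : ℝ → T} (h0 : c 0 = x)
    (h : ∀ a ∈ Icc (0 : ℝ) (dist x y), ∀ b ∈ Icc (0 : ℝ) (dist x y),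
      dist (c a) (c b) = |a - b|) {a : ℝ} (ha : a ∈ Icc (0 : ℝ) (dist x y)) :
    dist x (c a) = a := by
  have := h 0 ⟨le_rfl, dist_nonneg⟩ a ha
  rw [h0] at this
  rw [this, zero_sub, abs_neg, abs_of_nonneg ha.1]

lemma dist_geod_end {x y : T} {c : ℝ → T} (h1 : c (dist x y) = y)
    (h : ∀ a ∈ Icc (0 : ℝ) (dist x y), ∀ b ∈ Icc (0 : ℝ) (dist x y),
      dist (c a) (c b) = |a - b|) {a : ℝ} (ha : a ∈ Icc (0 : ℝ) (dist x y)) :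
    dist (c a) y = dist x y - a := by
  have := h a ha (dist x y) ⟨dist_nonneg, le_rfl⟩
  rw [h1] at this
  rw [this, abs_of_nonpos (by linarith [ha.2])]
  ring

lemma IsRTree.exists_median (hT : IsRTree T) (x y z : T) :
    ∃ m, m ∈ seg x y ∧ m ∈ seg x z ∧ m ∈ seg y z := by
  obtain ⟨c₁, h10, h11, h1⟩ := hT.exists_geod x y
  obtain ⟨c₂, h20, h21, h2⟩ := hT.exists_geod x z
  obtain ⟨s, hs, hsy, hsz, hm, hmax⟩ := exists_max_agree dist_nonneg dist_nonneg
    (continuousOn_of_dist_eq h1) (continuousOn_of_dist_eq h2) (h10.trans h20.symm)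
  refine ⟨c₁ s, ?_, ?_, hT.mem_seg_of_branch hs hsy hsz h10 h11 h20 h21 h1 h2 hm hmax⟩
  · rw [mem_seg, dist_zero_geod h10 h1 ⟨hs, hsy⟩, dist_geod_end h11 h1 ⟨hs, hsy⟩]; ring
  · rw [hm, mem_seg, dist_zero_geod h20 h2 ⟨hs, hsz⟩, dist_geod_end h21 h2 ⟨hs, hsz⟩]; ring

lemma IsRTree.geod_eq_of_mem_seg (hT : IsRTree T) {x y p : T} {c : ℝ → T} (hp : p ∈ seg x y)
    (h0 : c 0 = x) (h1 : c (dist x y) = y)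
    (h : ∀ a ∈ Icc (0 : ℝ) (dist x y), ∀ b ∈ Icc (0 : ℝ) (dist x y),
      dist (c a) (c b) = |a - b|) : c (dist x p) = p := by
  obtain ⟨c₂, h20, h21, h2⟩ := hT.exists_geod x p
  obtain ⟨s, hs, hsy, hsz, hm, hmax⟩ := exists_max_agree dist_nonneg dist_nonneg
    (continuousOn_of_dist_eq h) (continuousOn_of_dist_eq h2) (h0.trans h20.symm)
  have hmem := hT.mem_seg_of_branch hs hsy hsz h0 h1 h20 h21 h h2 hm hmax
  have e1 := dist_zero_geod h0 h ⟨hs, hsy⟩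
  have e2 := dist_geod_end h1 h ⟨hs, hsy⟩
  have e3 := dist_geod_end h21 h2 ⟨hs, hsz⟩
  rw [mem_seg] at hp hmem
  rw [← hm] at e3
  have e4 := dist_comm y p
  have e5 := dist_comm y (c s)
  have e6 : s = dist x p := by linarith
  rw [← e6]
  exact dist_le_zero.mp (by linarith)

lemma IsRTree.dist_of_mem_seg (hT : IsRTree T) {x y p q : T} (hp : p ∈ seg x y)
    (hq : q ∈ seg x y) (h : dist x p ≤ dist x q) : dist p q = dist x q - dist x p := by
  obtain ⟨c, h0, h1, hc⟩ := hT.exists_geod x y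
  have le : ∀ p ∈ seg x y, dist x p ≤ dist x y := fun p hp => by
    rw [mem_seg] at hp
    linarith [dist_nonneg (x := p) (y := y)]
  have := hc _ ⟨dist_nonneg, le p hp⟩ _ ⟨dist_nonneg, le q hq⟩
  rw [hT.geod_eq_of_mem_seg hp h0 h1 hc, hT.geod_eq_of_mem_seg hq h0 h1 hc] at this
  rw [this, abs_of_nonpos (by linarith)]
  ring

theorem IsRTree.treeLike (hT : IsRTree T) : TreeLike T := by
  refine ⟨hT.exists_geod, fun x y z w => ?_⟩
  obtain ⟨m, hm1, hm2, hm3⟩ := hT.exists_median x y z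
  obtain ⟨n, hn1, hn2, hn3⟩ := hT.exists_median x y w
  rw [mem_seg] at *
  have t1 := dist_triangle z m w
  have t2 := dist_triangle m n w
  have e1 := dist_comm z m
  have e2 := dist_comm m y
  have e3 := dist_comm n y
  have e4 := dist_comm y z
  rcases le_total (dist x m) (dist x n) with h | h
  · have := hT.dist_of_mem_seg hm1 hn1 h
    right; linarith
  · have := hT.dist_of_mem_seg hn1 hm1 h
    rw [dist_comm] at this
    left; linarith

end RTreeToTreeLike

section Segments

variable {T : Type*} [MetricSpace T]

lemma seg_comm (x y : T) : seg x y = seg y x := by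
  ext p
  rw [mem_seg, mem_seg, dist_comm x p, dist_comm p y, dist_comm x y, add_comm]

lemma left_mem_seg (x y : T) : x ∈ seg x y := by simp [seg]

lemma right_mem_seg (x y : T) : y ∈ seg x y := by simp [seg]

lemma eq_of_mem_seg_self {x p : T} (h : p ∈ seg x x) : p = x := by
  rw [mem_seg, dist_self, dist_comm p x] at h
  exact (dist_le_zero.mp (by linarith)).symm

lemma mem_seg_left_trans {x y m w : T} (hm : m ∈ seg x y) (hw : w ∈ seg x m) : w ∈ seg x y := by
  rw [mem_seg] at *
  linarith [dist_triangle x w y, dist_triangle w m y]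

lemma mem_seg_right_of_left {x y m w : T} (hm : m ∈ seg x y) (hw : w ∈ seg x m) :
    m ∈ seg w y := by
  rw [mem_seg] at *
  linarith [dist_triangle x w y, dist_triangle w m y]

lemma mem_seg_right_trans {x y m w : T} (hm : m ∈ seg x y) (hw : w ∈ seg m y) : w ∈ seg x y := by
  rw [seg_comm] at *
  exact mem_seg_left_trans hm hw

lemma mem_seg_left_of_right {x y m w : T} (hm : m ∈ seg x y) (hw : w ∈ seg m y) :
    m ∈ seg x w := by
  rw [seg_comm] at *
  exact mem_seg_right_of_left hm hw

lemma isClosed_seg (x y : T) : IsClosed (seg x y) := by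
  apply isClosed_eq <;> fun_prop

lemma dist_le_of_mem_seg {x y p : T} (h : p ∈ seg x y) : dist x p ≤ dist x y := by
  rw [mem_seg] at h
  linarith [dist_nonneg (x := p) (y := y)]

namespace TreeLike

variable (hT : TreeLike T)
include hT

lemma exists_mem_seg (x y : T) {t : ℝ} (h0 : 0 ≤ t) (h1 : t ≤ dist x y) :
    ∃ p ∈ seg x y, dist x p = t := by
  obtain ⟨c, hc0, hc1, hc⟩ := hT.exists_geod x y
  refine ⟨c t, ?_, dist_zero_geod hc0 hc ⟨h0, h1⟩⟩
  rw [mem_seg, dist_zero_geod hc0 hc ⟨h0, h1⟩, dist_geod_end hc1 hc ⟨h0, h1⟩]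
  ring

lemma eq_of_dist_eq {x y p q : T} (hp : p ∈ seg x y) (hq : q ∈ seg x y)
    (h : dist x p = dist x q) : p = q := by
  rw [mem_seg] at *
  have e1 := dist_comm y p
  have e2 := dist_comm y q
  apply dist_le_zero.mp
  rcases hT.four_point x y p q with h' | h' <;> linarith

lemma dist_of_mem_seg {x y p q : T} (hp : p ∈ seg x y) (hq : q ∈ seg x y)
    (h : dist x p ≤ dist x q) : p ∈ seg x q := by
  rw [mem_seg] at *
  have e1 := dist_comm y p
  have e2 := dist_comm y q
  rcases hT.four_point x y p q with h' | h' <;>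
    linarith [dist_triangle x p q, dist_triangle p q y]

lemma isPreconnected_seg (x y : T) : IsPreconnected (seg x y) := by
  obtain ⟨c, hc0, hc1, hc⟩ := hT.exists_geod x y
  have : seg x y = c '' Icc 0 (dist x y) := by
    ext p
    constructor
    · intro hp
      have hI : dist x p ∈ Icc 0 (dist x y) := ⟨dist_nonneg, dist_le_of_mem_seg hp⟩
      refine ⟨dist x p, hI, ?_⟩
      apply hT.eq_of_dist_eq _ hp (dist_zero_geod hc0 hc hI)
      rw [mem_seg, dist_zero_geod hc0 hc hI, dist_geod_end hc1 hc hI]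
      ring
    · rintro ⟨t, ht, rfl⟩
      rw [mem_seg, dist_zero_geod hc0 hc ht, dist_geod_end hc1 hc ht]
      ring
  rw [this]
  exact isPreconnected_Icc.image _ (continuousOn_of_dist_eq hc)

lemma mem_seg_or {x y m : T} (hm : m ∈ seg x y) (w : T) : m ∈ seg x w ∨ m ∈ seg w y := by
  simp only [mem_seg] at *
  have e1 := dist_comm y m
  have e2 := dist_comm y w
  have e3 := dist_comm m w
  rcases hT.four_point x y m w with h' | h'
  · right; linarith [dist_triangle w m y]
  · left; linarith [dist_triangle x m w]

lemma mem_seg_chain {a b c e : T} (hb : b ∈ seg a c) (hc : c ∈ seg b e) (hbc : b ≠ c) :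
    b ∈ seg a e ∧ c ∈ seg a e := by
  have hpos := dist_pos.mpr hbc
  simp only [mem_seg] at *
  have e1 := dist_comm c b
  rcases hT.four_point a c b e with h' | h'
  · linarith
  · constructor <;>
      linarith [dist_triangle a b e, dist_triangle a c e]

lemma exists_median (x y z : T) : ∃ m, m ∈ seg x y ∧ m ∈ seg x z ∧ m ∈ seg y z := by
  have e1 := dist_comm y z
  have e2 := dist_comm x y
  have e3 := dist_comm x z
  obtain ⟨m, hm, hmt⟩ := hT.exists_mem_seg x y
    (t := (dist x y + dist x z - dist y z) / 2)
    (by linarith [dist_triangle y x z]) (by linarith [dist_triangle x y z])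
  refine ⟨m, hm, ?_⟩
  simp only [mem_seg] at *
  have e4 := dist_comm y m
  have e5 := dist_comm z m
  rcases hT.four_point x y z m with h' | h' <;>
    constructor <;> linarith [dist_triangle x m z, dist_triangle y m z]

lemma seg_subset {a b x y : T} (hx : x ∈ seg a b) (hy : y ∈ seg a b) : seg x y ⊆ seg a b := by
  rcases le_total (dist a x) (dist a y) with h | h
  · intro p hp
    exact mem_seg_left_trans hy (mem_seg_right_trans (hT.dist_of_mem_seg hx hy h) hp)
  · intro p hp
    rw [seg_comm] at hp
    exact mem_seg_left_trans hx (mem_seg_right_trans (hT.dist_of_mem_seg hy hx h) hp)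

/-- A point of a segment separates its endpoints. -/
lemma mem_of_isPreconnected {S : Set T} (hS : IsPreconnected S) {x y m : T} (hx : x ∈ S)
    (hy : y ∈ S) (hm : m ∈ seg x y) : m ∈ S := by
  by_contra hmS
  have hxm : x ≠ m := fun h => hmS (h ▸ hx)
  have hym : y ≠ m := fun h => hmS (h ▸ hy)
  have hU : IsOpen {w | m ∉ seg x w} := by
    have : IsClosed {w | m ∈ seg x w} := by
      apply isClosed_eq <;> fun_prop
    exact this.isOpen_compl
  have hV : IsOpen {w | m ≠ w ∧ m ∈ seg x w} := by
    rw [Metric.isOpen_iff]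
    rintro w ⟨hmw, hw⟩
    refine ⟨dist m w, dist_pos.mpr hmw, fun w' hw' => ?_⟩
    rw [Metric.mem_ball] at hw'
    refine ⟨fun h => by subst h; exact lt_irrefl _ hw', ?_⟩
    simp only [mem_seg] at *
    have e1 := dist_comm w' w
    have e2 := dist_comm w m
    rcases hT.four_point x w m w' with h' | h' <;>
      linarith [dist_triangle x m w', dist_triangle x w' w, dist_nonneg (x := m) (y := w')]
  obtain ⟨w, -, hw1, hw2⟩ := hS _ _ hU hV
    (fun w hw => by
      by_cases h : m ∈ seg x w
      · exact Or.inr ⟨fun h' => hmS (h' ▸ hw), h⟩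
      · exact Or.inl h)
    ⟨x, hx, fun h => hxm (eq_of_mem_seg_self h).symm⟩ ⟨y, hy, hym.symm, hm⟩
  exact hw1 hw2.2

lemma range_eq_seg {x y : T} (γ : Path x y) (hγ : Injective γ) : range γ = seg x y := by
  have himg : ∀ s t : unitInterval, s ≤ t → ∀ m ∈ seg (γ s) (γ t), ∃ r, s ≤ r ∧ r ≤ t ∧ γ r = m := by
    intro s t hst m hm
    have hpre : IsPreconnected (γ '' Icc s t) := isPreconnected_Icc.image _ γ.continuous.continuousOn
    obtain ⟨r, hr, hrm⟩ := hT.mem_of_isPreconnected hpre ⟨s, ⟨le_rfl, hst⟩, rfl⟩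
      ⟨t, ⟨hst, le_rfl⟩, rfl⟩ hm
    exact ⟨r, hr.1, hr.2, hrm⟩
  ext p
  constructor
  · rintro ⟨t, rfl⟩
    obtain ⟨m, hm1, hm2, hm3⟩ := hT.exists_median x (γ t) y
    obtain ⟨r, -, hrt, hr⟩ := himg 0 t unitInterval.nonneg' m (by rwa [γ.source])
    obtain ⟨r', hrt', -, hr'⟩ := himg t 1 unitInterval.le_one' m (by rwa [γ.target])
    have : r = r' := hγ (hr.trans hr'.symm)
    have h2 : r = t := le_antisymm hrt (this ▸ hrt')
    rw [← h2, hr]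
    exact hm2
  · intro hp
    obtain ⟨r, -, -, hr⟩ := himg 0 1 unitInterval.nonneg' p (by rwa [γ.source, γ.target])
    exact ⟨r, hr⟩

theorem isRTree : IsRTree T :=
  ⟨hT.exists_geod, fun x y γ₁ γ₂ h₁ h₂ => by
    rw [hT.range_eq_seg γ₁ h₁, hT.range_eq_seg γ₂ h₂]⟩

end TreeLike

end Segments

section Directions

variable {T : Type*} [MetricSpace T]

/-- The direction at `x` pointing towards `y`. -/
def dir (x y : T) : Set T := {w | x ∉ seg y w}

lemma mem_dir {x y w : T} : w ∈ dir x y ↔ x ∉ seg y w := Iff.rfl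

lemma notMem_dir {x y w : T} : w ∉ dir x y ↔ x ∈ seg y w := not_not

lemma mem_dir_comm {x y w : T} : w ∈ dir x y ↔ y ∈ dir x w := by
  rw [mem_dir, mem_dir, seg_comm]

lemma self_mem_dir {x y : T} (h : y ≠ x) : y ∈ dir x y :=
  fun h' => h (eq_of_mem_seg_self h').symm

lemma base_notMem_dir (x y : T) : x ∉ dir x y := fun h => h (right_mem_seg y x)

lemma mem_dir_of_mem_seg_of_ne {x y w : T} (h : w ∈ seg x y) (hne : w ≠ x) : w ∈ dir x y := by
  intro h'
  apply hne
  rw [mem_seg] at *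
  apply dist_le_zero.mp
  linarith [dist_comm w x, dist_comm w y, dist_comm x y]

lemma ne_of_mem_dir {x y w : T} (h : w ∈ dir x y) : w ≠ x :=
  fun h' => base_notMem_dir x y (h' ▸ h)

lemma isOpen_dir (x y : T) : IsOpen (dir x y) := by
  have : IsClosed {w | x ∈ seg y w} := by
    apply isClosed_eq <;> fun_prop
  exact this.isOpen_compl

lemma mem_dir_of_dist_lt {x y w w' : T} (h : w ∈ dir x y) (hd : dist w w' < dist w x)
    (hT : TreeLike T) : w' ∈ dir x y := by
  intro h'
  rcases hT.mem_seg_or h' w with h1 | h1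
  · exact h h1
  · rw [mem_seg] at h1
    linarith [dist_nonneg (x := x) (y := w')]

namespace TreeLike

variable (hT : TreeLike T)
include hT

lemma mem_dir_trans {x y w v : T} (h1 : w ∈ dir x y) (h2 : v ∈ dir x w) : v ∈ dir x y := by
  intro h
  rcases hT.mem_seg_or h w with h | h
  · exact h1 h
  · exact h2 h

lemma dir_eq_of_mem {x y w : T} (h : w ∈ dir x y) : dir x w = dir x y := by
  ext v
  exact ⟨hT.mem_dir_trans h, hT.mem_dir_trans (mem_dir_comm.mp h)⟩

lemma connectedComponentIn_eq {x y : T} (h : y ≠ x) :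
    connectedComponentIn {x}ᶜ y = dir x y := by
  apply Subset.antisymm
  · intro w hw hx
    have := hT.mem_of_isPreconnected isPreconnected_connectedComponentIn
      (mem_connectedComponentIn (F := {x}ᶜ) h) hw hx
    exact connectedComponentIn_subset _ _ this rfl
  · intro w hw
    apply (hT.isPreconnected_seg y w).subset_connectedComponentIn (left_mem_seg y w) _
      (right_mem_seg y w)
    intro p hp hpx
    rw [mem_singleton_iff] at hpx
    exact hw (hpx ▸ hp)

lemma isDirectionAt_iff {δ : Set T} {x : T} : IsDirectionAt δ x ↔ ∃ y, y ≠ x ∧ δ = dir x y := by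
  constructor
  · rintro ⟨y, hy, rfl⟩
    exact ⟨y, hy, hT.connectedComponentIn_eq hy⟩
  · rintro ⟨y, hy, rfl⟩
    exact ⟨y, hy, (hT.connectedComponentIn_eq hy).symm⟩

lemma isDirection_iff {δ : Set T} : IsDirection δ ↔ ∃ x y, y ≠ x ∧ δ = dir x y :=
  exists_congr fun _ => hT.isDirectionAt_iff

lemma isDirection_dir {x y : T} (h : y ≠ x) : IsDirection (dir x y) :=
  hT.isDirection_iff.mpr ⟨x, y, h, rfl⟩

lemma treeConvex_compl_dir (x y : T) : TreeConvex (dir x y)ᶜ := by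
  intro a ha b hb p hp
  rw [mem_compl_iff, notMem_dir] at *
  rcases hT.mem_seg_or ha p with h | h
  · exact h
  rcases hT.mem_seg_or hb p with h' | h'
  · exact h'
  have : x = p := by
    rw [mem_seg] at *
    apply dist_le_zero.mp
    have e1 := dist_comm x p
    have e2 := dist_comm a p
    have e3 := dist_comm x a
    linarith [dist_triangle a x b]
  rw [this]
  exact right_mem_seg y p

/-- Two directions with a common point are nested or cover the tree. -/
lemma dir_nested_or_cover {x y x' y' w : T} (h : w ∈ dir x y) (h' : w ∈ dir x' y') :
    dir x y ⊆ dir x' y' ∨ dir x' y' ⊆ dir x y ∨ dir x y ∪ dir x' y' = univ := by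
  rw [← hT.dir_eq_of_mem h, ← hT.dir_eq_of_mem h']
  by_contra! hcon
  obtain ⟨h1, h2, h3⟩ := hcon
  obtain ⟨v, hv⟩ := (ne_univ_iff_exists_notMem _).mp h3
  rw [mem_union, not_or, notMem_dir, notMem_dir] at hv
  rcases le_total (dist w x) (dist w x') with hle | hle
  · apply h1
    intro u hu hu'
    exact hu (mem_seg_left_trans hu' (hT.dist_of_mem_seg hv.1 hv.2 hle))
  · apply h2
    intro u hu hu'
    exact hu (mem_seg_left_trans hu' (hT.dist_of_mem_seg hv.2 hv.1 hle))

end TreeLike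

end Directions

section Action

variable {G T : Type*} [Group G] [MetricSpace T] [MulAction G T]

lemma smul_mem_seg (hiso : IsometricAction G T) (g : G) {x y p : T} :
    g • p ∈ seg (g • x) (g • y) ↔ p ∈ seg x y := by
  simp only [mem_seg, hiso g]

lemma smul_mem_dir (hiso : IsometricAction G T) (g : G) {x y p : T} :
    g • p ∈ dir (g • x) (g • y) ↔ p ∈ dir x y := by
  simp only [mem_dir, smul_mem_seg hiso]

/-- When the minimal subtree is dense, every orbit meets every direction. -/
lemma exists_smul_mem_dir (hT : TreeLike T) (hiso : IsometricAction G T)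
    (hd : Dense (minSubtree G T)) {x y : T} (h : y ≠ x) (p : T) : ∃ g : G, g • p ∈ dir x y := by
  by_contra! hcon
  let S : Set T := {w | ∀ g : G, g • w ∉ dir x y}
  have hS : minSubtree G T ⊆ S := by
    apply sInter_subset_of_mem
    refine ⟨⟨p, hcon⟩, ?_, ?_⟩
    · intro a ha b hb w hw g
      exact hT.treeConvex_compl_dir x y _ (ha g) _ (hb g) ((smul_mem_seg hiso g).mpr hw)
    · intro g _ w hw g'
      rw [smul_smul]
      exact hw _
  obtain ⟨w, hw, hwS⟩ := hd.inter_open_nonempty _ (isOpen_dir x y) ⟨y, self_mem_dir h⟩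
  have := hS hwS 1
  rw [one_smul] at this
  exact this hw

end Action

section Hyperbolic

variable {G T : Type*} [Group G] [MulAction G T]

lemma Hyperbolic.inv {g : G} (hg : Hyperbolic T g) : Hyperbolic T g⁻¹ := by
  intro x hx
  apply hg x
  rwa [inv_smul_eq_iff, eq_comm] at hx

lemma Hyperbolic.conj {g : G} (hg : Hyperbolic T g) (h : G) : Hyperbolic T (h * g * h⁻¹) := by
  intro x hx
  apply hg (h⁻¹ • x)
  rwa [mul_smul, mul_smul, ← eq_inv_smul_iff] at hx

lemma pow_smul_eq_of_smul_eq {g : G} {x : T} (h : g • x = x) (n : ℕ) : g ^ n • x = x := by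
  induction n with
  | zero => simp
  | succ n ih => rw [pow_succ, mul_smul, h, ih]

end Hyperbolic

section Dynamics

variable {G T : Type*} [Group G] [MetricSpace T] [MulAction G T]

/-- A hyperbolic isometry has a point on its axis. -/
lemma Hyperbolic.exists_axis (hT : TreeLike T) (hiso : IsometricAction G T) {g : G}
    (hg : Hyperbolic T g) (y : T) : ∃ x : T, g • x ∈ seg x (g • g • x) := by
  obtain ⟨m, hm, hmd⟩ := hT.exists_mem_seg (g • y) y (t := dist (g • y) y / 2)
    (by positivity) (by linarith [dist_nonneg (x := g • y) (y := y)])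
  have hm' := (smul_mem_seg hiso g).mpr hm
  have hmd' : dist (g • y) (g • m) = dist (g • y) y / 2 := by
    rw [mem_seg] at hm
    rw [hiso, dist_comm y m]
    linarith
  obtain ⟨c, hc1, hc2, hc3⟩ := hT.exists_median (g • y) y (g • g • y)
  rcases le_or_gt (dist (g • y) y / 2) (dist (g • y) c) with h | h
  · exfalso
    rw [seg_comm] at hm'
    apply hg m
    have e1 := hT.dist_of_mem_seg hm hc1 (hmd.le.trans h)
    have e2 := hT.dist_of_mem_seg hm' hc2 (hmd'.le.trans h)
    exact hT.eq_of_dist_eq e2 e1 (hmd'.trans hmd.symm)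
  · have hcd : dist (g • g • y) (g • c) < dist (g • y) y / 2 := by rwa [hiso]
    have hcm := hT.dist_of_mem_seg hc1 hm (h.le.trans hmd.ge)
    have hcm' := hT.dist_of_mem_seg hc2 (by rwa [seg_comm] at hm') (h.le.trans hmd'.ge)
    have hne : c ≠ g • m := by
      rintro rfl
      linarith
    have hne' : g • m ≠ g • c := by
      intro h'
      have : m = c := MulAction.injective g h'
      rw [this] at hmd
      linarith
    have k1 : c ∈ seg m (g • m) := by
      have a1 : c ∈ seg m (g • g • y) := by
        refine mem_seg_right_of_left hc3 ?_
        rw [seg_comm]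
        exact mem_seg_right_of_left hm hcm
      refine mem_seg_left_of_right a1 ?_
      exact mem_seg_right_of_left (by rwa [seg_comm] at hm') hcm'
    have k2 : g • m ∈ seg c (g • c) := by
      have a1 : g • m ∈ seg (g • y) (g • c) := by
        rw [seg_comm]
        exact mem_seg_right_of_left hm' ((smul_mem_seg hiso g).mpr hcm)
      exact mem_seg_right_of_left a1 hcm'
    have k3 := (hT.mem_seg_chain k1 k2 hne).2
    exact ⟨m, (hT.mem_seg_chain k3 ((smul_mem_seg hiso g).mpr k1) hne').1⟩

/-- The iterates of a point on an axis are aligned. -/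
lemma pow_smul_mem_seg (hT : TreeLike T) (hiso : IsometricAction G T) {g : G} {x : T}
    (hx : g • x ∈ seg x (g • g • x)) (hne : g • x ≠ x) (n : ℕ) :
    g ^ n • x ∈ seg x (g ^ (n + 1) • x) := by
  induction n with
  | zero => simpa using left_mem_seg _ _
  | succ n ih =>
    have h1 : g ^ (n + 1) • x ∈ seg (g ^ n • x) (g ^ (n + 1 + 1) • x) := by
      have := (smul_mem_seg hiso (g ^ n)).mpr hx
      rwa [smul_smul, smul_smul, smul_smul, ← pow_succ, ← pow_succ] at this
    refine (hT.mem_seg_chain ih h1 fun h => hne ?_).2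
    rw [pow_succ, mul_smul] at h
    exact (MulAction.injective _ h).symm

lemma dist_pow_smul (hT : TreeLike T) (hiso : IsometricAction G T) {g : G} {x : T}
    (hx : g • x ∈ seg x (g • g • x)) (hne : g • x ≠ x) (n : ℕ) :
    dist x (g ^ n • x) = n * dist x (g • x) := by
  induction n with
  | zero => simp
  | succ n ih =>
    have := pow_smul_mem_seg hT hiso hx hne n
    rw [mem_seg, ih, pow_succ, mul_smul, hiso] at this
    rw [pow_succ, mul_smul, ← this]
    push_cast
    ring

lemma inv_smul_mem_seg_axis (hiso : IsometricAction G T) {g : G} {x : T}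
    (hx : g • x ∈ seg x (g • g • x)) : g⁻¹ • x ∈ seg x (g⁻¹ • g⁻¹ • x) := by
  rw [← smul_mem_seg hiso g, ← smul_mem_seg hiso g, seg_comm]
  simpa using hx

lemma smul_mem_seg_axis_conj (hiso : IsometricAction G T) {g : G} {x : T}
    (hx : g • x ∈ seg x (g • g • x)) (h : G) :
    (h * g * h⁻¹) • h • x ∈ seg (h • x) ((h * g * h⁻¹) • (h * g * h⁻¹) • h • x) := by
  simp only [mul_smul, inv_smul_smul]
  exact (smul_mem_seg hiso h).mpr hx

lemma pow_smul_mem_seg_add (hT : TreeLike T) (hiso : IsometricAction G T) {g : G} {x : T}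
    (hx : g • x ∈ seg x (g • g • x)) (hne : g • x ≠ x) (m n : ℕ) :
    g ^ m • x ∈ seg x (g ^ (m + n) • x) := by
  rw [mem_seg, pow_add, mul_smul, hiso, ← mul_smul, ← pow_add]
  simp only [dist_pow_smul hT hiso hx hne]
  push_cast
  ring

lemma eventually_dist_pow_smul (hT : TreeLike T) (hiso : IsometricAction G T) {g : G} {x : T}
    (hx : g • x ∈ seg x (g • g • x)) (hne : g • x ≠ x) (p q : T) (R : ℝ) :
    ∀ᶠ n : ℕ in atTop, R < dist (g ^ n • p) q := by
  have hpos : 0 < dist x (g • x) := dist_pos.mpr hne.symm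
  have hlim : Tendsto (fun n : ℕ => (n : ℝ) * dist x (g • x)) atTop atTop :=
    tendsto_natCast_atTop_atTop.atTop_mul_const hpos
  filter_upwards [hlim.eventually_gt_atTop (R + dist p x + dist x q)] with n hn
  rw [← dist_pow_smul hT hiso hx hne] at hn
  have e := hiso (g ^ n) p x
  linarith [dist_triangle x q (g ^ n • x), dist_triangle q (g ^ n • p) (g ^ n • x),
    dist_comm q (g ^ n • p)]

/-- Positive powers of a hyperbolic isometry move every point away to infinity. -/
lemma Hyperbolic.eventually_dist (hT : TreeLike T) (hiso : IsometricAction G T) {g : G}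
    (hg : Hyperbolic T g) (p q : T) (R : ℝ) : ∀ᶠ n : ℕ in atTop, R < dist (g ^ n • p) q := by
  obtain ⟨x, hx⟩ := hg.exists_axis hT hiso p
  exact eventually_dist_pow_smul hT hiso hx (hg x) p q R

/-- Every direction contains the attracting end of some hyperbolic isometry. -/
lemma exists_hyperbolic_mem_dir (hT : TreeLike T) (hiso : IsometricAction G T)
    (hnt : NontrivialAction G T) (hd : Dense (minSubtree G T)) {x y : T} (hxy : y ≠ x) :
    ∃ g : G, Hyperbolic T g ∧ ∀ (p q : T) (R : ℝ),
      ∀ᶠ n : ℕ in atTop, g ^ n • p ∈ dir x y ∧ R < dist (g ^ n • p) q := by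
  obtain ⟨g, a, hg, ha, hga⟩ : ∃ (g : G) (a : T), Hyperbolic T g ∧ g • a ∈ seg a (g • g • a) ∧
      ∀ n : ℕ, g ^ n • a ∈ dir x y := by
    obtain ⟨h, hh⟩ := hnt
    change Hyperbolic T h at hh
    obtain ⟨a₀, ha₀⟩ := hh.exists_axis hT hiso x
    obtain ⟨k, hk⟩ := exists_smul_mem_dir hT hiso hd hxy a₀
    set a := k • a₀
    have hg := hh.conj k
    have ha := smul_mem_seg_axis_conj hiso ha₀ k
    set g := k * h * k⁻¹
    by_cases hcase : ∀ n : ℕ, g ^ n • a ∈ dir x y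
    · exact ⟨g, a, hg, ha, hcase⟩
    · refine ⟨g⁻¹, a, hg.inv, inv_smul_mem_seg_axis hiso ha, fun m => ?_⟩
      push Not at hcase
      obtain ⟨n, hn⟩ := hcase
      by_contra hm
      rw [← hT.dir_eq_of_mem hk, notMem_dir] at hn hm
      have hmid : a ∈ seg (g⁻¹ ^ m • a) (g ^ n • a) := by
        rw [← smul_mem_seg hiso (g ^ m), inv_pow, smul_inv_smul, smul_smul, ← pow_add]
        exact pow_smul_mem_seg_add hT hiso ha (hg a) m n
      apply ne_of_mem_dir hk
      rw [mem_seg] at *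
      apply dist_le_zero.mp
      linarith [dist_triangle (g⁻¹ ^ m • a) x (g ^ n • a), dist_comm a (g⁻¹ ^ m • a),
        dist_comm x (g⁻¹ ^ m • a)]
  refine ⟨g, hg, fun p q R => ?_⟩
  filter_upwards [eventually_dist_pow_smul hT hiso ha (hg a) p q R,
    eventually_dist_pow_smul hT hiso ha (hg a) a x (dist p a)] with n h1 h2
  refine ⟨mem_dir_of_dist_lt (hga n) ?_ hT, h1⟩
  rwa [hiso, dist_comm a p]

end Dynamics

section

variable {G T : Type*} [Group G] [MetricSpace T] [MulAction G T]

lemma mem_dir_and_dist_of_far (hT : TreeLike T) (hiso : IsometricAction G T) {x y p q : T}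
    {R : ℝ} {g : G} (hR : 0 ≤ R) (hg : g • p ∈ dir x y)
    (hd : R + dist p x + 2 * dist p q < dist (g • p) p) :
    g • q ∈ dir x y ∧ R < dist (g • q) q := by
  have e := hiso g p q
  have e' := dist_comm p q
  have := dist_triangle (g • p) x p
  have := dist_triangle (g • p) (g • q) p
  have := dist_triangle (g • q) q p
  have e2 := dist_comm p x
  refine ⟨mem_dir_of_dist_lt hg ?_ hT, ?_⟩ <;>
    linarith [dist_nonneg (x := p) (y := q), dist_nonneg (x := p) (y := x)]

end

section HeavyQuadrants

variable {G T₁ T₂ : Type*} [Group G] [MetricSpace T₁] [MetricSpace T₂]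
  [MulAction G T₁] [MulAction G T₂]

lemma Heavy.mono {Q Q' : Set (T₁ × T₂)} (h : Heavy G Q) (hQ : Q ⊆ Q') : Heavy G Q' := by
  intro p
  obtain ⟨γ, h1, h2⟩ := h p
  exact ⟨γ, fun k => hQ (h1 k), h2⟩

lemma Heavy.exists_smul_mem {δ₁ : Set T₁} {δ₂ : Set T₂} (h : Heavy G (δ₁ ×ˢ δ₂)) (p₁ : T₁)
    (p₂ : T₂) (R : ℝ) : ∃ g : G, g • p₁ ∈ δ₁ ∧ g • p₂ ∈ δ₂ ∧
      R < dist (g • p₁) p₁ ∧ R < dist (g • p₂) p₂ := by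
  obtain ⟨γ, h1, h2, h3⟩ := h (p₁, p₂)
  obtain ⟨k, hk2, hk3⟩ := ((h2.eventually_gt_atTop R).and (h3.eventually_gt_atTop R)).exists
  exact ⟨γ k, (h1 k).1, (h1 k).2, hk2, hk3⟩

/-- Heaviness of a quadrant can be tested on a single base point. -/
lemma heavy_of_forall_exists (hT₁ : TreeLike T₁) (hT₂ : TreeLike T₂)
    (hiso₁ : IsometricAction G T₁) (hiso₂ : IsometricAction G T₂) {x₁ y₁ : T₁} {x₂ y₂ : T₂}
    (p₁ : T₁) (p₂ : T₂)
    (h : ∀ R : ℝ, ∃ g : G, g • p₁ ∈ dir x₁ y₁ ∧ g • p₂ ∈ dir x₂ y₂ ∧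
      R < dist (g • p₁) p₁ ∧ R < dist (g • p₂) p₂) : Heavy G (dir x₁ y₁ ×ˢ dir x₂ y₂) := by
  intro q
  choose γ h1 h2 h3 h4 using fun k : ℕ => h (k + (dist p₁ x₁ + 2 * dist p₁ q.1) +
    (dist p₂ x₂ + 2 * dist p₂ q.2))
  have n1 : 0 ≤ dist p₁ x₁ + 2 * dist p₁ q.1 := by positivity
  have n2 : 0 ≤ dist p₂ x₂ + 2 * dist p₂ q.2 := by positivity
  have k1 : ∀ k, _ := fun k => mem_dir_and_dist_of_far hT₁ hiso₁ (q := q.1) (Nat.cast_nonneg k) (h1 k)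
    (by linarith [h3 k])
  have k2 : ∀ k, _ := fun k => mem_dir_and_dist_of_far hT₂ hiso₂ (q := q.2) (Nat.cast_nonneg k) (h2 k)
    (by linarith [h4 k])
  exact ⟨γ, fun k => ⟨(k1 k).1, (k2 k).1⟩,
    tendsto_atTop_mono (fun k => (k1 k).2.le) tendsto_natCast_atTop_atTop,
    tendsto_atTop_mono (fun k => (k2 k).2.le) tendsto_natCast_atTop_atTop⟩

lemma Heavy.smul (hT₁ : TreeLike T₁) (hT₂ : TreeLike T₂)
    (hiso₁ : IsometricAction G T₁) (hiso₂ : IsometricAction G T₂) {x₁ y₁ : T₁} {x₂ y₂ : T₂}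
    (h : Heavy G (dir x₁ y₁ ×ˢ dir x₂ y₂)) (g : G) :
    Heavy G (dir (g • x₁) (g • y₁) ×ˢ dir (g • x₂) (g • y₂)) := by
  refine heavy_of_forall_exists hT₁ hT₂ hiso₁ hiso₂ x₁ x₂ fun R => ?_
  obtain ⟨k, k1, k2, k3, k4⟩ := h.exists_smul_mem x₁ x₂
    (R + dist (g • x₁) x₁ + dist (g • x₂) x₂)
  refine ⟨g * k, ?_, ?_, ?_, ?_⟩
  · rw [mul_smul]; exact (smul_mem_dir hiso₁ g).mpr k1
  · rw [mul_smul]; exact (smul_mem_dir hiso₂ g).mpr k2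
  · rw [mul_smul]
    linarith [hiso₁ g (k • x₁) x₁, dist_triangle (g • k • x₁) x₁ (g • x₁),
      dist_nonneg (x := g • x₂) (y := x₂), dist_comm x₁ (g • x₁)]
  · rw [mul_smul]
    linarith [hiso₂ g (k • x₂) x₂, dist_triangle (g • k • x₂) x₂ (g • x₂),
      dist_nonneg (x := g • x₁) (y := x₁), dist_comm x₂ (g • x₂)]

lemma mem_core_iff (hT₁ : TreeLike T₁) (hT₂ : TreeLike T₂) {z : T₁ × T₂} :
    z ∈ Core G T₁ T₂ ↔ ∀ x₁ x₂, z.1 ≠ x₁ → z.2 ≠ x₂ →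
      Heavy G (dir x₁ z.1 ×ˢ dir x₂ z.2) := by
  constructor
  · intro h x₁ x₂ h1 h2
    exact h _ ⟨_, _, hT₁.isDirection_dir h1, hT₂.isDirection_dir h2, rfl⟩
      ⟨self_mem_dir h1, self_mem_dir h2⟩
  · rintro h Q ⟨δ₁, δ₂, h1, h2, rfl⟩ hz
    obtain ⟨x₁, y₁, -, rfl⟩ := hT₁.isDirection_iff.mp h1
    obtain ⟨x₂, y₂, -, rfl⟩ := hT₂.isDirection_iff.mp h2
    rw [← hT₁.dir_eq_of_mem hz.1, ← hT₂.dir_eq_of_mem hz.2]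
    exact h _ _ (ne_of_mem_dir hz.1) (ne_of_mem_dir hz.2)

lemma heavy_of_mem_core (hT₁ : TreeLike T₁) (hT₂ : TreeLike T₂) {z₁ : T₁} {z₂ : T₂}
    (h : (z₁, z₂) ∈ Core G T₁ T₂) {x₁ y₁ : T₁} {x₂ y₂ : T₂} (h1 : z₁ ∈ dir x₁ y₁)
    (h2 : z₂ ∈ dir x₂ y₂) : Heavy G (dir x₁ y₁ ×ˢ dir x₂ y₂) := by
  rw [← hT₁.dir_eq_of_mem h1, ← hT₂.dir_eq_of_mem h2]
  exact (mem_core_iff hT₁ hT₂).mp h _ _ (ne_of_mem_dir h1) (ne_of_mem_dir h2)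

lemma smul_mem_core (hT₁ : TreeLike T₁) (hT₂ : TreeLike T₂)
    (hiso₁ : IsometricAction G T₁) (hiso₂ : IsometricAction G T₂) {z₁ : T₁} {z₂ : T₂}
    (h : (z₁, z₂) ∈ Core G T₁ T₂) (g : G) : (g • z₁, g • z₂) ∈ Core G T₁ T₂ := by
  rw [mem_core_iff hT₁ hT₂]
  intro x₁ x₂ h1 h2
  have := ((mem_core_iff hT₁ hT₂).mp h (g⁻¹ • x₁) (g⁻¹ • x₂)
    (fun h' => h1 (by simpa using congrArg (g • ·) h'))
    (fun h' => h2 (by simpa using congrArg (g • ·) h'))).smul hT₁ hT₂ hiso₁ hiso₂ g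
  simpa only [smul_inv_smul] using this

/-- Every direction of `T₁` forms a heavy quadrant with one of two given facing directions
of `T₂`. -/
lemma heavy_or_heavy_of_facing (hT₁ : TreeLike T₁) (hT₂ : TreeLike T₂)
    (hiso₁ : IsometricAction G T₁) (hiso₂ : IsometricAction G T₂)
    (hnt₁ : NontrivialAction G T₁) (hnt₂ : NontrivialAction G T₂)
    (hd₁ : Dense (minSubtree G T₁)) {x₁ y₁ : T₁} (h : y₁ ≠ x₁) {x₂ y₂ x₂' y₂' : T₂}
    (hface : dir x₂ y₂ ∪ dir x₂' y₂' = univ) :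
    Heavy G (dir x₁ y₁ ×ˢ dir x₂ y₂) ∨ Heavy G (dir x₁ y₁ ×ˢ dir x₂' y₂') := by
  have far : ∀ R : ℝ, ∃ g : G, g • y₁ ∈ dir x₁ y₁ ∧ R < dist (g • y₁) y₁ ∧
      R < dist (g • x₂) x₂ := by
    intro R
    obtain ⟨g, -, hg⟩ := exists_hyperbolic_mem_dir hT₁ hiso₁ hnt₁ hd₁ h
    by_cases hg₂ : Hyperbolic T₂ g
    · obtain ⟨n, hn1, hn2⟩ :=
        ((hg y₁ y₁ R).and (hg₂.eventually_dist hT₂ hiso₂ x₂ x₂ R)).exists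
      exact ⟨g ^ n, hn1.1, hn1.2, hn2⟩
    · unfold Hyperbolic at hg₂
      push Not at hg₂
      obtain ⟨q, hq⟩ := hg₂
      obtain ⟨k, hk⟩ := hnt₂
      obtain ⟨j, hj⟩ :=
        (Hyperbolic.eventually_dist hT₂ hiso₂ hk x₂ q (R + dist x₂ q)).exists
      obtain ⟨n, hn⟩ := (hg (k ^ j • y₁) y₁ R).exists
      refine ⟨g ^ n * k ^ j, ?_, ?_, ?_⟩
      · rw [mul_smul]; exact hn.1
      · rw [mul_smul]; exact hn.2
      · have hfix : g ^ n • q = q := pow_smul_eq_of_smul_eq hq n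
        have e := hiso₂ (g ^ n) (k ^ j • x₂) q
        rw [hfix] at e
        rw [mul_smul]
        linarith [dist_triangle (g ^ n • k ^ j • x₂) x₂ q]
  by_contra! hcon
  obtain ⟨hn, hn'⟩ := hcon
  have n1 := mt (heavy_of_forall_exists hT₁ hT₂ hiso₁ hiso₂ y₁ x₂) hn
  have n2 := mt (heavy_of_forall_exists hT₁ hT₂ hiso₁ hiso₂ y₁ x₂) hn'
  push Not at n1 n2
  obtain ⟨R, hR⟩ := n1
  obtain ⟨R', hR'⟩ := n2
  obtain ⟨g, hg1, hg2, hg3⟩ := far (max R R')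
  have hmem : g • x₂ ∈ dir x₂ y₂ ∪ dir x₂' y₂' := hface ▸ mem_univ _
  rcases hmem with hm | hm
  · exact absurd (hR g hg1 hm ((le_max_left _ _).trans_lt hg2))
      (not_le.mpr ((le_max_left _ _).trans_lt hg3))
  · exact absurd (hR' g hg1 hm ((le_max_right _ _).trans_lt hg2))
      (not_le.mpr ((le_max_right _ _).trans_lt hg3))

end HeavyQuadrants

section Connectedness

variable {G T₁ T₂ : Type*} [Group G] [MetricSpace T₁] [MetricSpace T₂]
  [MulAction G T₁] [MulAction G T₂]

namespace TreeLike

variable {T : Type*} [MetricSpace T] (hT : TreeLike T)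
include hT

lemma isCompact_seg (x y : T) : IsCompact (seg x y) := by
  obtain ⟨c, hc0, hc1, hc⟩ := hT.exists_geod x y
  refine (isCompact_Icc.image_of_continuousOn
    (continuousOn_of_dist_eq hc)).of_isClosed_subset (isClosed_seg x y) fun p hp => ?_
  have hI : dist x p ∈ Icc 0 (dist x y) := ⟨dist_nonneg, dist_le_of_mem_seg hp⟩
  refine ⟨dist x p, hI, hT.eq_of_dist_eq ?_ hp (dist_zero_geod hc0 hc hI)⟩
  rw [mem_seg, dist_zero_geod hc0 hc hI, dist_geod_end hc1 hc hI]
  ring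

lemma isPreconnected_of_treeConvex {S : Set T} (hS : TreeConvex S) : IsPreconnected S :=
  isPreconnected_of_forall_pair fun x hx y hy =>
    ⟨seg x y, hS x hx y hy, left_mem_seg x y, right_mem_seg x y, hT.isPreconnected_seg x y⟩

lemma mem_dir_of_mem_seg {x y a b w : T} (hw : w ∈ dir x y) (hwab : w ∈ seg a b)
    (ha : a ∉ dir x y) : b ∈ dir x y := by
  by_contra hb
  exact hT.treeConvex_compl_dir x y a ha b hb hwab hw

end TreeLike

lemma exists_light_of_notMem_core (hT₁ : TreeLike T₁) (hT₂ : TreeLike T₂) {z₁ : T₁} {z₂ : T₂}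
    (h : (z₁, z₂) ∉ Core G T₁ T₂) : ∃ (x₁ y₁ : T₁) (x₂ y₂ : T₂), z₁ ∈ dir x₁ y₁ ∧
      z₂ ∈ dir x₂ y₂ ∧ ¬ Heavy G (dir x₁ y₁ ×ˢ dir x₂ y₂) := by
  rw [mem_core_iff hT₁ hT₂] at h
  push Not at h
  obtain ⟨x₁, x₂, h1, h2, h3⟩ := h
  exact ⟨x₁, z₁, x₂, z₂, self_mem_dir h1, self_mem_dir h2, h3⟩

lemma isClosed_core (hT₁ : TreeLike T₁) (hT₂ : TreeLike T₂) : IsClosed (Core G T₁ T₂) := by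
  rw [← isOpen_compl_iff, isOpen_iff_mem_nhds]
  rintro ⟨z₁, z₂⟩ hz
  obtain ⟨x₁, y₁, x₂, y₂, h1, h2, h3⟩ := exists_light_of_notMem_core hT₁ hT₂ hz
  filter_upwards [((isOpen_dir x₁ y₁).prod (isOpen_dir x₂ y₂)).mem_nhds ⟨h1, h2⟩] with w hw hwc
  exact h3 (heavy_of_mem_core hT₁ hT₂ (z₁ := w.1) (z₂ := w.2) hwc hw.1 hw.2)

lemma treeConvex_core_fiber (hT₁ : TreeLike T₁) (hT₂ : TreeLike T₂) (x : T₁) :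
    TreeConvex {y : T₂ | (x, y) ∈ Core G T₁ T₂} := by
  intro a ha b hb w hw
  by_contra hcon
  obtain ⟨x₁, y₁, x₂, y₂, h1, h2, h3⟩ := exists_light_of_notMem_core hT₁ hT₂ hcon
  refine hT₂.treeConvex_compl_dir x₂ y₂ a (fun h => ?_) b (fun h => ?_) hw h2
  · exact h3 (heavy_of_mem_core hT₁ hT₂ ha h1 h)
  · exact h3 (heavy_of_mem_core hT₁ hT₂ hb h1 h)

variable (G T₁ T₂) in
/-- There are two light quadrants facing each other. -/
def HasFacingLightQuadrants : Prop :=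
  ∃ (x₁ y₁ x₁' y₁' : T₁) (x₂ y₂ x₂' y₂' : T₂), dir x₁ y₁ ∪ dir x₁' y₁' = univ ∧
    dir x₂ y₂ ∪ dir x₂' y₂' = univ ∧ ¬ Heavy G (dir x₁ y₁ ×ˢ dir x₂ y₂) ∧
    ¬ Heavy G (dir x₁' y₁' ×ˢ dir x₂' y₂')

/-- Without facing light quadrants, the fibers of the core over a segment joining the first
coordinates of two points of the core are nonempty. -/
lemma exists_mem_core_fiber (hT₁ : TreeLike T₁) (hT₂ : TreeLike T₂)
    (hiso₁ : IsometricAction G T₁) (hiso₂ : IsometricAction G T₂)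
    (hnt₁ : NontrivialAction G T₁) (hnt₂ : NontrivialAction G T₂)
    (hd₁ : Dense (minSubtree G T₁)) (hno : ¬ HasFacingLightQuadrants G T₁ T₂) {a₁ b₁ : T₁}
    {a₂ b₂ : T₂} (ha : (a₁, a₂) ∈ Core G T₁ T₂) (hb : (b₁, b₂) ∈ Core G T₁ T₂) {x : T₁}
    (hx : x ∈ seg a₁ b₁) : ∃ y ∈ seg a₂ b₂, (x, y) ∈ Core G T₁ T₂ := by
  by_contra! hcon
  let U : Set T₂ → Prop := fun δ => ∃ (x₁ y₁ : T₁) (x₂ y₂ : T₂), x ∈ dir x₁ y₁ ∧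
    δ = dir x₂ y₂ ∧ ¬ Heavy G (dir x₁ y₁ ×ˢ dir x₂ y₂)
  have hU : ∀ δ, U δ → a₂ ∉ δ ∨ b₂ ∉ δ := by
    rintro δ ⟨x₁, y₁, x₂, y₂, h1, rfl, h3⟩
    by_cases h : a₁ ∈ dir x₁ y₁
    · exact Or.inl fun h' => h3 (heavy_of_mem_core hT₁ hT₂ ha h h')
    · exact Or.inr fun h' =>
        h3 (heavy_of_mem_core hT₁ hT₂ hb (hT₁.mem_dir_of_mem_seg h1 hx h) h')
  have hUo : ∀ δ, U δ → IsOpen δ := by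
    rintro δ ⟨x₁, y₁, x₂, y₂, h1, rfl, h3⟩
    exact isOpen_dir _ _
  have hcov : ∀ y ∈ seg a₂ b₂, ∃ δ, U δ ∧ y ∈ δ := by
    intro y hy
    obtain ⟨x₁, y₁, x₂, y₂, h1, h2, h3⟩ := exists_light_of_notMem_core hT₁ hT₂ (hcon y hy)
    exact ⟨_, ⟨x₁, y₁, x₂, y₂, h1, rfl, h3⟩, h2⟩
  have hA : IsOpen (⋃₀ {δ | U δ ∧ a₂ ∉ δ}) := isOpen_sUnion fun δ hδ => hUo δ hδ.1
  have hB : IsOpen (⋃₀ {δ | U δ ∧ b₂ ∉ δ}) := isOpen_sUnion fun δ hδ => hUo δ hδ.1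
  obtain ⟨w, hw, ⟨δ, ⟨hδ, haδ⟩, hwδ⟩, ⟨δ', ⟨hδ', hbδ'⟩, hwδ'⟩⟩ :=
    hT₂.isPreconnected_seg a₂ b₂ _ _ hA hB
    (fun y hy => by
      obtain ⟨δ, h, hyδ⟩ := hcov y hy
      rcases hU δ h with h' | h'
      · exact Or.inl ⟨δ, ⟨h, h'⟩, hyδ⟩
      · exact Or.inr ⟨δ, ⟨h, h'⟩, hyδ⟩)
    (by
      obtain ⟨δ, h, hyδ⟩ := hcov b₂ (right_mem_seg _ _)
      exact ⟨b₂, right_mem_seg _ _, δ, ⟨h, (hU δ h).resolve_right (not_not.mpr hyδ)⟩, hyδ⟩)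
    (by
      obtain ⟨δ, h, hyδ⟩ := hcov a₂ (left_mem_seg _ _)
      exact ⟨a₂, left_mem_seg _ _, δ, ⟨h, (hU δ h).resolve_left (not_not.mpr hyδ)⟩, hyδ⟩)
  obtain ⟨x₁, y₁, x₂, y₂, h1, rfl, h3⟩ := hδ
  obtain ⟨x₁', y₁', x₂', y₂', h1', rfl, h3'⟩ := hδ'
  have hcover : dir x₂ y₂ ∪ dir x₂' y₂' = univ := by
    rcases hT₂.dir_nested_or_cover hwδ hwδ' with h | h | h
    · exact absurd (h (hT₂.mem_dir_of_mem_seg hwδ hw haδ)) hbδ'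
    · exact absurd (h (hT₂.mem_dir_of_mem_seg hwδ' (by rwa [seg_comm]) hbδ')) haδ
    · exact h
  have hne : ∀ {x₁ y₁ : T₁}, x ∈ dir x₁ y₁ → y₁ ≠ x₁ := fun h =>
    ne_of_mem_dir (hT₁.mem_dir_trans h (mem_dir_comm.mp h))
  rcases hT₁.dir_nested_or_cover h1 h1' with h | h | h
  · rcases heavy_or_heavy_of_facing hT₁ hT₂ hiso₁ hiso₂ hnt₁ hnt₂ hd₁ (hne h1) hcover with k | k
    · exact h3 k
    · exact h3' (k.mono (prod_mono h subset_rfl))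
  · rcases heavy_or_heavy_of_facing hT₁ hT₂ hiso₁ hiso₂ hnt₁ hnt₂ hd₁ (hne h1') hcover with k | k
    · exact h3 (k.mono (prod_mono h subset_rfl))
    · exact h3' k
  · exact hno ⟨x₁, y₁, x₁', y₁', x₂, y₂, x₂', y₂', h, hcover, h3, h3'⟩

theorem isPreconnected_core (hT₁ : TreeLike T₁) (hT₂ : TreeLike T₂)
    (hiso₁ : IsometricAction G T₁) (hiso₂ : IsometricAction G T₂)
    (hnt₁ : NontrivialAction G T₁) (hnt₂ : NontrivialAction G T₂)
    (hd₁ : Dense (minSubtree G T₁)) (hno : ¬ HasFacingLightQuadrants G T₁ T₂) :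
    IsPreconnected (Core G T₁ T₂) := by
  refine isPreconnected_of_forall_pair ?_
  rintro ⟨a₁, a₂⟩ ha ⟨b₁, b₂⟩ hb
  refine ⟨Core G T₁ T₂ ∩ seg a₁ b₁ ×ˢ seg a₂ b₂, inter_subset_left,
    ⟨ha, left_mem_seg _ _, left_mem_seg _ _⟩, ⟨hb, right_mem_seg _ _, right_mem_seg _ _⟩, ?_⟩
  set t := Core G T₁ T₂ ∩ seg a₁ b₁ ×ˢ seg a₂ b₂ with ht
  have hcomp : IsCompact t :=
    ((hT₁.isCompact_seg a₁ b₁).prod (hT₂.isCompact_seg a₂ b₂)).inter_left (isClosed_core hT₁ hT₂)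
  have hproj : ∀ u : Set (T₁ × T₂), IsClosed u → IsClosed (Prod.fst '' (t ∩ u)) := fun u hu =>
    ((hcomp.inter_right hu).image continuous_fst).isClosed
  rw [isPreconnected_closed_iff]
  intro u v hu hv huv ⟨p, hp⟩ ⟨q, hq⟩
  obtain ⟨x, hx, ⟨⟨p₁, p₂⟩, hp', hxp⟩, ⟨⟨q₁, q₂⟩, hq', hxq⟩⟩ :=
    isPreconnected_closed_iff.mp (hT₁.isPreconnected_seg a₁ b₁) _ _ (hproj u hu) (hproj v hv)
      (fun x hx => by
        obtain ⟨y, hy, hxy⟩ :=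
          exists_mem_core_fiber hT₁ hT₂ hiso₁ hiso₂ hnt₁ hnt₂ hd₁ hno ha hb hx
        have hm : (x, y) ∈ t := ⟨hxy, hx, hy⟩
        rcases huv hm with h | h
        · exact Or.inl ⟨_, ⟨hm, h⟩, rfl⟩
        · exact Or.inr ⟨_, ⟨hm, h⟩, rfl⟩)
      ⟨p.1, hp.1.2.1, p, hp, rfl⟩ ⟨q.1, hq.1.2.1, q, hq, rfl⟩
  dsimp only at hxp hxq
  subst hxp hxq
  have hF : IsPreconnected {y : T₂ | (q₁, y) ∈ t} := by
    refine hT₂.isPreconnected_of_treeConvex fun y hy y' hy' w hw => ?_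
    exact ⟨treeConvex_core_fiber hT₁ hT₂ q₁ y hy.1 y' hy'.1 hw, hx,
      hT₂.seg_subset hy.2.2 hy'.2.2 hw⟩
  have hcont : Continuous fun y : T₂ => (q₁, y) := by fun_prop
  obtain ⟨y, hy, hyu, hyv⟩ := isPreconnected_closed_iff.mp hF _ _ (hu.preimage hcont)
    (hv.preimage hcont) (fun y hy => huv hy) ⟨p₂, hp'.1, hp'.2⟩ ⟨q₂, hq'.1, hq'.2⟩
  exact ⟨(q₁, y), hy, hyu, hyv⟩

end Connectedness

section AlignPreserving

variable {T T' : Type*} [MetricSpace T] [MetricSpace T']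

/-- Fibers of alignment preserving maps have gates. -/
lemma AlignPreserving.exists_gate (hT : TreeLike T) (hT' : TreeLike T') {f : T → T'}
    (hf : AlignPreserving f) (hc : Continuous f) {m : T'} (hm : m ∈ range f) {x : T}
    (hx : f x ≠ m) : ∃ q, f q = m ∧ q ≠ x ∧ ∀ w ∈ dir q x, f w ∈ dir m (f x) := by
  obtain ⟨y, rfl⟩ := hm
  have hK : IsCompact (seg x y ∩ f ⁻¹' {f y}) :=
    (hT.isCompact_seg x y).inter_right (isClosed_singleton.preimage hc)
  obtain ⟨q, ⟨hq, hqm⟩, hmin⟩ := hK.exists_isMinOn ⟨y, right_mem_seg x y, rfl⟩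
    (f := fun q => dist x q) (by fun_prop)
  have hqm : f q = f y := hqm
  refine ⟨q, hqm, fun h => hx (h ▸ hqm), fun w hw hwm => hw ?_⟩
  obtain ⟨p, hp, hpm⟩ := hT'.mem_of_isPreconnected
    ((hT.isPreconnected_seg x w).image f hc.continuousOn) ⟨x, left_mem_seg x w, rfl⟩
    ⟨w, right_mem_seg x w, rfl⟩ hwm
  obtain ⟨c, hc1, hc2, hc3⟩ := hT.exists_median x q p
  have hcm : f c = f y := by
    have := hf _ _ _ hc3
    rw [hqm, hpm] at this
    exact eq_of_mem_seg_self this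
  have hle : dist x q ≤ dist x c := hmin ⟨mem_seg_left_trans hq hc1, hcm⟩
  have : c = q := by
    rw [mem_seg] at hc1
    exact dist_le_zero.mp (by linarith)
  exact mem_seg_left_trans hp (this ▸ hc2)

end AlignPreserving

section Simplicial

variable {T : Type*} [MetricSpace T]

lemma dir_ne_dir_of_mem_seg {n x y : T} (h : n ∈ seg x y) (hx : x ≠ n) :
    dir n x ≠ dir n y := by
  intro h'
  have := h' ▸ self_mem_dir hx
  exact mem_dir_comm.mp this h

lemma TreeLike.isBranchPoint_median (hT : TreeLike T) {x y z n : T} (h1 : n ∈ seg x y)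
    (h2 : n ∈ seg x z) (h3 : n ∈ seg y z) (hx : x ≠ n) (hy : y ≠ n) (hz : z ≠ n) :
    IsBranchPoint n :=
  ⟨dir n x, dir n y, dir n z, hT.isDirectionAt_iff.mpr ⟨x, hx, rfl⟩,
    hT.isDirectionAt_iff.mpr ⟨y, hy, rfl⟩, hT.isDirectionAt_iff.mpr ⟨z, hz, rfl⟩,
    dir_ne_dir_of_mem_seg h1 hx, dir_ne_dir_of_mem_seg h2 hx, dir_ne_dir_of_mem_seg h3 hy⟩

lemma IsSimplicialStructure.exists_seg_disjoint (hT : TreeLike T) {V : Set T}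
    (hV : IsSimplicialStructure V) {u v : T} (huv : u ≠ v) :
    ∃ c ∈ seg u v, ∃ d ∈ seg u v, c ≠ d ∧ ∀ p ∈ seg c d, p ∉ V := by
  set F := dist u '' (seg u v ∩ V)
  have hF : F.Finite := (hV.2.1 u v).image _
  have hpos := dist_pos.mpr huv
  have hopen : IsOpen (Ioo 0 (dist u v) \ F) := isOpen_Ioo.sdiff hF.isClosed
  obtain ⟨t, ht⟩ := ((Ioo_infinite hpos).sdiff hF).nonempty
  obtain ⟨ε, hε, hball⟩ := Metric.isOpen_iff.mp hopen t ht
  have hmem : ∀ s, t ≤ s → s ≤ t + ε / 2 → s ∈ Ioo 0 (dist u v) \ F := fun s h1 h2 => by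
    apply hball
    rw [Metric.mem_ball, Real.dist_eq, abs_of_nonneg (by linarith)]
    linarith
  have h2 := hmem (t + ε / 2) (by linarith) le_rfl
  obtain ⟨d, hd, hdt⟩ := hT.exists_mem_seg u v (t := t + ε / 2) h2.1.1.le h2.1.2.le
  obtain ⟨c, hc, hct⟩ := hT.exists_mem_seg u d (t := t) ht.1.1.le (by linarith)
  refine ⟨c, mem_seg_left_trans hd hc, d, hd, ?_, fun p hp hpV => ?_⟩
  · rintro rfl
    linarith
  · have hpd := mem_seg_right_trans hc hp
    have hcp := mem_seg_left_of_right hc hp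
    refine (hmem (dist u p) ?_ ?_).2 ⟨p, ⟨mem_seg_left_trans hd hpd, hpV⟩, rfl⟩
    · rw [← hct]; exact dist_le_of_mem_seg hcp
    · rw [← hdt]; exact dist_le_of_mem_seg hpd

/-- The open edges of a simplicial tree are unbranched. -/
lemma IsSimplicialStructure.mem_seg_of_mem_dir (hT : TreeLike T) {V : Set T}
    (hV : IsSimplicialStructure V) {c d w : T} (hcd : ∀ p ∈ seg c d, p ∉ V)
    (h1 : w ∈ dir c d) (h2 : w ∈ dir d c) : w ∈ seg c d := by
  obtain ⟨n, n1, n2, n3⟩ := hT.exists_median c d w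
  by_contra hw
  refine hcd n n1 (hV.1 n (hT.isBranchPoint_median n1 n2 n3 ?_ ?_ ?_))
  · rintro rfl; exact h1 n3
  · rintro rfl; exact h2 n2
  · rintro rfl; exact hw n1

end Simplicial

section Refinement

variable {G : Type*} [Group G]

/-- The preimage of an open edge under a refinement map is contained in a segment. -/
lemma IsRefinementMap.mem_seg_of_mem_edge {T T' : Type*} [MetricSpace T] [MetricSpace T']
    [MulAction G T] [MulAction G T'] (hT : TreeLike T) (hT' : TreeLike T')
    (hiso : IsometricAction G T) (hnt : NontrivialAction G T) (hd : Dense (minSubtree G T))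
    {f : T → T'} (hf : IsRefinementMap G f) {V : Set T'} (hV : IsSimplicialStructure V)
    {y z w : T} (hyz : f y ≠ f z) (hcd : ∀ p ∈ seg (f y) (f z), p ∉ V)
    (hw : f w ∈ seg (f y) (f z)) (hwy : f w ≠ f y) (hwz : f w ≠ f z) : w ∈ seg y z := by
  obtain ⟨-, -, hal, heq⟩ := hf
  obtain ⟨n, n1, n2, n3⟩ := hT.exists_median y z w
  by_contra hcon
  have hne : w ≠ n := fun h => hcon (h ▸ n1)
  have hny : f n ≠ f y := by
    intro h
    have := hal _ _ _ n3
    rw [h, seg_comm] at this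
    apply hwy
    rw [mem_seg] at this hw
    apply dist_le_zero.mp
    linarith [dist_comm (f w) (f y), dist_comm (f w) (f z), dist_comm (f z) (f y),
      dist_nonneg (x := f w) (y := f y)]
  have hnz : f n ≠ f z := by
    intro h
    have := hal _ _ _ n2
    rw [h, seg_comm] at this
    apply hwz
    rw [mem_seg] at this hw
    apply dist_le_zero.mp
    linarith [dist_comm (f w) (f y), dist_comm (f w) (f z), dist_comm (f z) (f y),
      dist_nonneg (x := f w) (y := f z)]
  have hconst : ∀ v ∈ dir n w, f v = f n := by
    intro v hv
    by_contra hvn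
    have v1 : n ∈ seg y v := (hT.mem_seg_or n2 v).resolve_right
      (by rw [seg_comm]; exact hv)
    have v2 : n ∈ seg z v := (hT.mem_seg_or n3 v).resolve_right
      (by rw [seg_comm]; exact hv)
    exact hcd _ (hal _ _ _ n1) (hV.1 _ (hT'.isBranchPoint_median (hal _ _ _ n1) (hal _ _ _ v1)
      (hal _ _ _ v2) hny.symm hnz.symm hvn))
  obtain ⟨g, -, hg⟩ := exists_hyperbolic_mem_dir hT hiso hnt hd hne
  obtain ⟨k, k1, k2⟩ := ((hg y y 0).and (hg z z 0)).exists
  have := (hconst _ k1.1).trans (hconst _ k2.1).symm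
  rw [heq, heq] at this
  exact hyz (MulAction.injective _ this)

variable {T₁ T₂ : Type*} [MetricSpace T₁] [MetricSpace T₂] [MulAction G T₁] [MulAction G T₂]

lemma IsRefinementMap.eq_of_mem_core {T' : Type*} [MetricSpace T'] [MulAction G T']
    (hT₁ : TreeLike T₁) (hT₂ : TreeLike T₂) (hT' : TreeLike T')
    {f₁ : T₁ → T'} (hf₁ : IsRefinementMap G f₁) {f₂ : T₂ → T'} (hf₂ : IsRefinementMap G f₂)
    {x₁ : T₁} {x₂ : T₂} (hx : (x₁, x₂) ∈ Core G T₁ T₂) : f₁ x₁ = f₂ x₂ := by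
  obtain ⟨c₁, s₁, a₁, e₁⟩ := hf₁
  obtain ⟨c₂, s₂, a₂, e₂⟩ := hf₂
  by_contra hne
  have hpos := dist_pos.mpr hne
  obtain ⟨m, hm, hmd⟩ := hT'.exists_mem_seg (f₁ x₁) (f₂ x₂) (t := dist (f₁ x₁) (f₂ x₂) / 2)
    (by linarith) (by linarith)
  obtain ⟨q₁, -, h1, h1'⟩ := a₁.exists_gate hT₁ hT' c₁ (s₁ m) (x := x₁) (by
    rintro rfl
    rw [dist_self] at hmd
    linarith)
  obtain ⟨q₂, -, h2, h2'⟩ := a₂.exists_gate hT₂ hT' c₂ (s₂ m) (x := x₂) (by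
    rintro rfl
    linarith)
  obtain ⟨p₂, hp⟩ := s₂ (f₁ x₁)
  obtain ⟨g, g1, g2, -⟩ := (heavy_of_mem_core hT₁ hT₂ hx (self_mem_dir h1.symm)
    (self_mem_dir h2.symm)).exists_smul_mem x₁ p₂ 0
  have m1 := h1' _ g1
  have m2 := h2' _ g2
  rw [e₂, hp, ← e₁] at m2
  exact hT'.mem_dir_trans m1 (mem_dir_comm.mp m2) hm

/-- If two trees refine a common nontrivial simplicial tree, their core is not connected. -/
theorem not_isConnected_core_of_refineCommonSimplicial (hT₁ : TreeLike T₁) (hT₂ : TreeLike T₂)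
    (hiso₁ : IsometricAction G T₁) (hnt₁ : NontrivialAction G T₁)
    (hd₁ : Dense (minSubtree G T₁)) (hiso₂ : IsometricAction G T₂)
    (href : RefineCommonSimplicial G T₁ T₂) : ¬ IsConnected (Core G T₁ T₂) := by
  rintro ⟨⟨⟨z₁, z₂⟩, hz⟩, hconn⟩
  obtain ⟨T', ⟨g, hg⟩, ⟨f₁, hf₁⟩, ⟨f₂, hf₂⟩⟩ := href
  have hT' := T'.tree.treeLike
  have hV := T'.simp
  obtain ⟨c, hc, d, hd, hcd, hcdV⟩ := hV.exists_seg_disjoint hT' (hg (f₁ z₁)).symm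
  have hpos := dist_pos.mpr hcd
  obtain ⟨m, hm, hmd⟩ := hT'.exists_mem_seg c d (t := dist c d / 2) (by linarith) (by linarith)
  have hmc : m ≠ c := by
    rintro rfl
    rw [dist_self] at hmd
    linarith
  have hmd' : m ≠ d := by
    rintro rfl
    linarith
  obtain ⟨⟨x₁, x₂⟩, hx, hxm⟩ := hT'.mem_of_isPreconnected
    (hconn.image (fun z => f₁ z.1) (hf₁.1.comp continuous_fst).continuousOn)
    ⟨_, hz, rfl⟩ ⟨_, smul_mem_core hT₁ hT₂ hiso₁ hiso₂ hz g, hf₁.2.2.2 g z₁⟩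
    (hT'.seg_subset hc hd hm)
  dsimp only at hxm
  have hxm₂ : f₂ x₂ = m := (hf₁.eq_of_mem_core hT₁ hT₂ hT' hf₂ hx).symm.trans hxm
  obtain ⟨q₁, -, h1, h1'⟩ := hf₁.2.2.1.exists_gate hT₁ hT' hf₁.1 (hf₁.2.1 c) (hxm.trans_ne hmc)
  obtain ⟨q₂, -, h2, h2'⟩ := hf₂.2.2.1.exists_gate hT₂ hT' hf₂.1 (hf₂.2.1 d)
    (hxm₂.trans_ne hmd')
  obtain ⟨y, rfl⟩ := hf₁.2.1 c
  obtain ⟨z, rfl⟩ := hf₁.2.1 d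
  have hseg : ∀ w, f₁ w ∈ seg (f₁ y) (f₁ z) → f₁ w ≠ f₁ y → f₁ w ≠ f₁ z → w ∈ seg y z :=
    fun w => hf₁.mem_seg_of_mem_edge hT₁ hT' hiso₁ hnt₁ hd₁ hV hcd hcdV
  obtain ⟨k, k1, k2, k3, -⟩ := (heavy_of_mem_core hT₁ hT₂ hx (self_mem_dir h1.symm)
    (self_mem_dir h2.symm)).exists_smul_mem x₁ x₂ (dist y z)
  have m1 := h1' _ k1
  have m2 := h2' _ k2
  rw [hf₂.2.2.2, hxm₂, ← hxm, ← hf₁.2.2.2] at m2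
  rw [hxm] at m1 m2
  have hm1 : m ∈ dir (f₁ y) (f₁ z) := mem_dir_of_mem_seg_of_ne hm hmc
  have hm2 : m ∈ dir (f₁ z) (f₁ y) :=
    mem_dir_of_mem_seg_of_ne (by rwa [seg_comm]) hmd'
  have hk := hseg (k • x₁) (hV.mem_seg_of_mem_dir hT' hcdV (hT'.mem_dir_trans hm1 m1)
    (hT'.mem_dir_trans hm2 m2)) (ne_of_mem_dir m1) (ne_of_mem_dir m2)
  have hx₁ := hseg x₁ (hxm ▸ hm) (hxm.trans_ne hmc) (hxm.trans_ne hmd')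
  rcases le_total (dist y (k • x₁)) (dist y x₁) with h | h
  · have := hT₁.dist_of_mem_seg hk hx₁ h
    rw [mem_seg] at this hx₁
    linarith [dist_nonneg (x := y) (y := k • x₁), dist_nonneg (x := x₁) (y := z)]
  · have := hT₁.dist_of_mem_seg hx₁ hk h
    rw [mem_seg] at this hk
    linarith [dist_nonneg (x := y) (y := x₁), dist_nonneg (x := k • x₁) (y := z),
      dist_comm x₁ (k • x₁)]

end Refinement

section Height

variable {T : Type*} [MetricSpace T]

/-- The position of the projection of `x` to the segment `[a, b]`, normalised to be `1` at `a`
and `0` at `b`. -/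
def height (a b x : T) : ℝ := (dist x b - dist x a + dist a b) / (2 * dist a b)

lemma height_sub {a b : T} (x y : T) : height a b x - height a b y =
    ((dist x b - dist x a) - (dist y b - dist y a)) / (2 * dist a b) := by
  unfold height
  ring

lemma continuous_height (a b : T) : Continuous (height a b) := by
  unfold height
  fun_prop

lemma height_smul {G : Type*} [Group G] [MulAction G T] (hiso : IsometricAction G T) (g : G)
    (a b x : T) : height (g • a) (g • b) (g • x) = height a b x := by
  simp only [height, hiso g]

lemma height_eq_one_iff {a b x : T} (hab : a ≠ b) : height a b x = 1 ↔ a ∈ seg b x := by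
  have := dist_pos.mpr hab
  rw [height, div_eq_one_iff_eq (by positivity), mem_seg, dist_comm b a, dist_comm a x,
    dist_comm b x]
  constructor <;> intro h <;> linarith

lemma height_eq_zero_iff {a b x : T} (hab : a ≠ b) : height a b x = 0 ↔ b ∈ seg a x := by
  have := dist_pos.mpr hab
  rw [height, div_eq_zero_iff, mem_seg, dist_comm b x, dist_comm a x]
  constructor
  · rintro (h | h) <;> linarith
  · intro h
    left
    linarith

namespace TreeLike

variable (hT : TreeLike T)
include hT

/-- Heights are monotone along segments. -/
lemma height_mono (a b : T) {x y p : T} (hp : p ∈ seg x y) :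
    height a b x ≤ height a b p ∧ height a b p ≤ height a b y ∨
      height a b y ≤ height a b p ∧ height a b p ≤ height a b x := by
  suffices h : dist x b - dist x a ≤ dist p b - dist p a ∧
        dist p b - dist p a ≤ dist y b - dist y a ∨
      dist y b - dist y a ≤ dist p b - dist p a ∧
        dist p b - dist p a ≤ dist x b - dist x a by
    have hm : ∀ {u v : T}, dist u b - dist u a ≤ dist v b - dist v a →
        height a b u ≤ height a b v := fun h => by
      unfold height
      gcongr
    exact h.imp (fun h => ⟨hm h.1, hm h.2⟩) (fun h => ⟨hm h.1, hm h.2⟩)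
  have e1 := dist_comm a p
  have e2 := dist_comm b p
  have e3 := dist_comm a y
  have e4 := dist_comm b y
  have e5 := dist_comm p y
  have t1 := dist_triangle x p a
  have t2 := dist_triangle x p b
  have t3 := dist_triangle y p a
  have t4 := dist_triangle y p b
  rcases hT.mem_seg_or hp a with h | h <;> rcases hT.mem_seg_or hp b with h' | h' <;>
    rw [mem_seg] at h h'
  · rcases le_total (dist p b - dist p a) (dist y b - dist y a) with k | k
    · left; constructor <;> linarith
    · right; constructor <;> linarith
  · left; constructor <;> linarith
  · right; constructor <;> linarith
  · rcases le_total (dist p b - dist p a) (dist x b - dist x a) with k | k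
    · right; constructor <;> linarith
    · left; constructor <;> linarith

lemma abs_height_add (a b : T) {x y p : T} (hp : p ∈ seg x y) :
    |height a b x - height a b p| + |height a b p - height a b y| =
      |height a b x - height a b y| := by
  rcases hT.height_mono a b hp with ⟨h1, h2⟩ | ⟨h1, h2⟩
  · rw [abs_of_nonpos (by linarith), abs_of_nonpos (by linarith), abs_of_nonpos (by linarith)]
    ring
  · rw [abs_of_nonneg (by linarith), abs_of_nonneg (by linarith), abs_of_nonneg (by linarith)]
    ring

lemma height_eq_of_mem_seg {a b x y p : T} (h : height a b x = height a b y)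
    (hp : p ∈ seg x y) : height a b p = height a b x := by
  rcases hT.height_mono a b hp with ⟨h1, h2⟩ | ⟨h1, h2⟩ <;> linarith

lemma dist_eq_abs_sub {a b u v : T} (hu : u ∈ seg a b) (hv : v ∈ seg a b) :
    dist u v = |dist u b - dist v b| := by
  rcases le_total (dist a u) (dist a v) with h | h
  · have := hT.dist_of_mem_seg hu hv h
    rw [mem_seg] at *
    rw [abs_of_nonneg] <;> linarith
  · have := hT.dist_of_mem_seg hv hu h
    rw [mem_seg] at *
    rw [abs_of_nonpos, dist_comm u v] <;> linarith

/-- Heights with respect to disjoint segments have a bounded total variation. -/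
lemma sum_abs_height_le {ι : Type*} (a b : ι → T) (hab : ∀ i, a i ≠ b i) (F : Finset ι)
    (hF : ∀ i ∈ F, ∀ j ∈ F, i ≠ j → height (a j) (b j) (a i) = height (a j) (b j) (b i))
    (x y : T) : ∑ i ∈ F, dist (a i) (b i) * |height (a i) (b i) x - height (a i) (b i) y| ≤
      dist x y := by
  classical
  induction F using Finset.induction_on generalizing x y with
  | empty => simp
  | insert i F hi ih =>
    have ih := ih fun j hj k hk =>
      hF j (Finset.mem_insert_of_mem hj) k (Finset.mem_insert_of_mem hk)
    rw [Finset.sum_insert hi]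
    have hpos := dist_pos.mpr (hab i)
    obtain ⟨u, u1, u2, u3⟩ := hT.exists_median x (a i) (b i)
    obtain ⟨v, v1, v2, v3⟩ := hT.exists_median y (a i) (b i)
    have hterm : dist (a i) (b i) * |height (a i) (b i) x - height (a i) (b i) y| =
        dist u v := by
      rw [hT.dist_eq_abs_sub u3 v3, ← abs_of_pos hpos, ← abs_mul, height_sub]
      congr 1
      rw [mem_seg] at *
      field_simp
      linarith [dist_comm u (a i), dist_comm v (a i)]
    rw [hterm]
    rcases eq_or_ne u v with rfl | huv
    · rw [dist_self, zero_add]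
      exact ih x y
    · have k : ∀ {x u v : T}, u ∈ seg x (a i) → u ∈ seg x (b i) → v ∈ seg (a i) (b i) →
          u ∈ seg x v := by
        intro x u v h1 h2 h3
        rcases hT.mem_seg_or h3 u with h | h
        · rw [seg_comm] at h
          exact mem_seg_left_of_right h1 h
        · exact mem_seg_left_of_right h2 h
      have k1 := k u1 u2 v3
      have k2 := k v1 v2 u3
      rw [seg_comm] at k2
      have k3 := (hT.mem_seg_chain k1 k2 huv).1
      have hsum : ∑ j ∈ F, dist (a j) (b j) * |height (a j) (b j) x - height (a j) (b j) y| ≤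
          ∑ j ∈ F, dist (a j) (b j) * |height (a j) (b j) x - height (a j) (b j) u| +
          ∑ j ∈ F, dist (a j) (b j) * |height (a j) (b j) v - height (a j) (b j) y| := by
        rw [← Finset.sum_add_distrib]
        refine Finset.sum_le_sum fun j hj => ?_
        have hc := hF i (Finset.mem_insert_self i F) j (Finset.mem_insert_of_mem hj)
          (fun h => hi (h ▸ hj))
        have e1 := hT.height_eq_of_mem_seg hc u3
        have e2 := hT.height_eq_of_mem_seg hc v3
        rw [← mul_add, e2, ← e1]
        gcongr
        exact abs_sub_le _ _ _
      have s1 := ih x u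
      have s2 := ih v y
      rw [mem_seg] at k3 k2
      linarith

end TreeLike

end Height

section CutPair

variable {G T : Type*} [Group G] [MetricSpace T] [MulAction G T]

/-- The points `a` and `b` separate the translates of `z` by the elements of `H` from the other
translates of `z`. -/
structure CutPair (H : Set G) (z a b : T) : Prop where
  ne : a ≠ b
  left : ∀ g ∈ H, a ∈ seg b (g • z)
  right : ∀ g ∉ H, b ∈ seg a (g • z)

namespace CutPair

variable {H K : Set G} {z a b a' b' : T}

lemma smul (hiso : IsometricAction G T) (h : CutPair H z a b) (γ : G) :
    CutPair (γ • H) z (γ • a) (γ • b) := by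
  refine ⟨fun h' => h.ne (MulAction.injective γ h'), fun g hg => ?_, fun g hg => ?_⟩ <;>
    rw [mem_smul_set_iff_inv_smul_mem] at hg
  · have := (smul_mem_seg hiso γ).mpr (h.left _ hg)
    rwa [smul_smul, smul_eq_mul, mul_inv_cancel_left] at this
  · have := (smul_mem_seg hiso γ).mpr (h.right _ hg)
    rwa [smul_smul, smul_eq_mul, mul_inv_cancel_left] at this

lemma height_of_mem (h : CutPair H z a b) {g : G} (hg : g ∈ H) : height a b (g • z) = 1 :=
  (height_eq_one_iff h.ne).mpr (h.left g hg)

lemma height_of_notMem (h : CutPair H z a b) {g : G} (hg : g ∉ H) : height a b (g • z) = 0 :=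
  (height_eq_zero_iff h.ne).mpr (h.right g hg)

lemma nonempty (hT : TreeLike T) (hiso : IsometricAction G T) (hd : Dense (minSubtree G T))
    (h : CutPair H z a b) : H.Nonempty := by
  obtain ⟨g, hg⟩ := exists_smul_mem_dir hT hiso hd h.ne z
  refine ⟨g, ?_⟩
  by_contra hgH
  exact hg (h.right g hgH)

lemma exists_notMem (hT : TreeLike T) (hiso : IsometricAction G T)
    (hd : Dense (minSubtree G T)) (h : CutPair H z a b) : ∃ g, g ∉ H := by
  obtain ⟨g, hg⟩ := exists_smul_mem_dir hT hiso hd h.ne.symm z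
  exact ⟨g, fun hgH => hg (h.left g hgH)⟩

lemma mem_seg (hT : TreeLike T) (h : CutPair H z a b) {g g' : G} (hg : g ∈ H) (hg' : g' ∉ H) :
    a ∈ seg (g • z) (g' • z) ∧ b ∈ seg (g • z) (g' • z) :=
  hT.mem_seg_chain (seg_comm b (g • z) ▸ h.left g hg) (h.right g' hg') h.ne

lemma mem_seg_mid (hT : TreeLike T) (h : CutPair H z a b) {g g' : G} (hg : g ∈ H)
    (hg' : g' ∉ H) : b ∈ seg a (g' • z) ∧ a ∈ seg (g • z) (g' • z) :=
  ⟨h.right g' hg', (h.mem_seg hT hg hg').1⟩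

/-- An element stabilising `H` fixes every point separating the two families of translates. -/
lemma smul_eq_of_forall_mem_seg (hT : TreeLike T) (hiso : IsometricAction G T) {γ : G}
    (hγ : γ • H = H) (hne : H.Nonempty) (hne' : ∃ g, g ∉ H) {y : T}
    (hy : ∀ g ∈ H, ∀ g' ∉ H, y ∈ seg (g • z) (g' • z)) : γ • y = y := by
  have hinv : ∀ g, γ⁻¹ * g ∈ H ↔ g ∈ H := fun g => by
    conv_rhs => rw [← hγ, mem_smul_set_iff_inv_smul_mem, smul_eq_mul]
  have hγy : ∀ g ∈ H, ∀ g' ∉ H, γ • y ∈ seg (g • z) (g' • z) := fun g hg g' hg' => by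
    have := (smul_mem_seg hiso γ).mpr (hy (γ⁻¹ * g) ((hinv g).mpr hg) (γ⁻¹ * g')
      (mt (hinv g').mp hg'))
    rwa [smul_smul, smul_smul, mul_inv_cancel_left, mul_inv_cancel_left] at this
  obtain ⟨g₀, hg₀⟩ := hne
  obtain ⟨g₁, hg₁⟩ := hne'
  let u : G → ℝ := fun g => dist (g • z) y
  have hu : ∀ g, u (γ⁻¹ * g) = dist (g • z) (γ • y) := fun g => by
    simp only [u]
    rw [← hiso γ ((γ⁻¹ * g) • z), smul_smul, mul_inv_cancel_left]
  have hsum : ∀ g ∈ H, ∀ g' ∉ H, u (γ⁻¹ * g) - u g = u g' - u (γ⁻¹ * g') :=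
    fun g hg g' hg' => by
      have h1 := hy g hg g' hg'
      have h2 := hγy g hg g' hg'
      rw [Guirardel.mem_seg, dist_comm _ (g' • z)] at h1 h2
      rw [hu, hu]
      simp only [u]
      linarith
  set κ := u (γ⁻¹ * g₀) - u g₀ with hκ
  have hin : ∀ g ∈ H, u (γ⁻¹ * g) = u g + κ := fun g hg => by
    linarith [hsum g hg g₁ hg₁, hsum g₀ hg₀ g₁ hg₁]
  have hout : ∀ g ∉ H, u (γ⁻¹ * g) = u g - κ := fun g hg => by
    linarith [hsum g₀ hg₀ g hg]
  have hin' : ∀ n : ℕ, ∀ g ∈ H, 0 ≤ u g + n * κ := by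
    intro n
    induction n with
    | zero => exact fun g _ => by simp [u]
    | succ n ih =>
      intro g hg
      have := ih _ ((hinv g).mpr hg)
      rw [hin g hg] at this
      push_cast
      linarith
  have hout' : ∀ n : ℕ, ∀ g ∉ H, 0 ≤ u g - n * κ := by
    intro n
    induction n with
    | zero => exact fun g _ => by simp [u]
    | succ n ih =>
      intro g hg
      have := ih _ (mt (hinv g).mp hg)
      rw [hout g hg] at this
      push_cast
      linarith
  have hκ0 : κ = 0 := by
    rcases lt_trichotomy κ 0 with h | h | h
    · obtain ⟨n, hn⟩ := exists_nat_gt (u g₀ / -κ)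
      rw [div_lt_iff₀ (by linarith)] at hn
      linarith [hin' n g₀ hg₀]
    · exact h
    · obtain ⟨n, hn⟩ := exists_nat_gt (u g₁ / κ)
      rw [div_lt_iff₀ h] at hn
      linarith [hout' n g₁ hg₁]
  refine hT.eq_of_dist_eq (hγy g₀ hg₀ g₁ hg₁) (hy g₀ hg₀ g₁ hg₁) ?_
  have := hin g₀ hg₀
  rw [hu, hκ0, add_zero] at this
  exact this

lemma smul_eq (hT : TreeLike T) (hiso : IsometricAction G T) (hd : Dense (minSubtree G T))
    (h : CutPair H z a b) {γ : G} (hγ : γ • H = H) : γ • a = a ∧ γ • b = b :=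
  ⟨smul_eq_of_forall_mem_seg hT hiso hγ (h.nonempty hT hiso hd) (h.exists_notMem hT hiso hd)
      fun _ hg _ hg' => (h.mem_seg hT hg hg').1,
    smul_eq_of_forall_mem_seg hT hiso hγ (h.nonempty hT hiso hd) (h.exists_notMem hT hiso hd)
      fun _ hg _ hg' => (h.mem_seg hT hg hg').2⟩

/-- The height defined by a cut pair is constant on the segment of a different cut pair. -/
lemma height_eq_height (hT : TreeLike T) (hiso : IsometricAction G T)
    (hd : Dense (minSubtree G T)) (h : CutPair H z a b) (h' : CutPair K z a' b')
    (hne : K ≠ H) (hne' : K ≠ Hᶜ) : height a' b' a = height a' b' b := by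
  by_contra hcon
  have key : ∀ g ∈ H, ∀ g' ∉ H, (g ∈ K ↔ g' ∉ K) := by
    intro g hg g' hg'
    obtain ⟨h1, h2⟩ := h.mem_seg_mid hT hg hg'
    have e1 := hT.abs_height_add a' b' h1
    have e2 := hT.abs_height_add a' b' h2
    have : 0 < |height a' b' a - height a' b' b| := abs_pos.mpr (sub_ne_zero.mpr hcon)
    have h3 : height a' b' (g • z) ≠ height a' b' (g' • z) := by
      intro h3
      rw [h3, sub_self, abs_zero] at e2
      linarith [abs_nonneg (height a' b' (g' • z) - height a' b' a),
        abs_nonneg (height a' b' b - height a' b' (g' • z))]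
    by_cases k : g ∈ K <;> by_cases k' : g' ∈ K
    · rw [h'.height_of_mem k, h'.height_of_mem k'] at h3
      exact absurd rfl h3
    · simp [k, k']
    · simp [k, k']
    · rw [h'.height_of_notMem k, h'.height_of_notMem k'] at h3
      exact absurd rfl h3
  obtain ⟨g₀, hg₀⟩ := h.nonempty hT hiso hd
  obtain ⟨g₁, hg₁⟩ := h.exists_notMem hT hiso hd
  by_cases hk : g₀ ∈ K
  · apply hne
    have h1 := (key g₀ hg₀ g₁ hg₁).mp hk
    ext g
    by_cases hg : g ∈ H
    · simp [hg, (key g hg g₁ hg₁).mpr h1]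
    · simp [hg, (key g₀ hg₀ g hg).mp hk]
  · apply hne'
    have h1 : g₁ ∈ K := by
      have := key g₀ hg₀ g₁ hg₁
      tauto
    ext g
    by_cases hg : g ∈ H
    · have := key g hg g₁ hg₁
      simp only [mem_compl_iff]
      tauto
    · have := key g₀ hg₀ g hg
      simp only [mem_compl_iff]
      tauto

end CutPair

/-- A chosen element translating `H` to a given point of its orbit. -/
def orbitRep {H : Set G} (K : MulAction.orbit G H) : G := K.2.choose

lemma orbitRep_smul {H : Set G} (K : MulAction.orbit G H) : orbitRep K • H = K :=
  K.2.choose_spec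

/-- The height with respect to the translate of `[a, b]` indexed by a translate of `H`. -/
def orbitHeight {H : Set G} (a b : T) (K : MulAction.orbit G H) (x : T) : ℝ :=
  height (orbitRep K • a) (orbitRep K • b) x

/-- The total variation of all the translates of a height function. -/
def cutDist (H : Set G) (a b x y : T) : ℝ :=
  ∑' K : MulAction.orbit G H, |orbitHeight a b K x - orbitHeight a b K y|

namespace CutPair

variable {H : Set G} {z a b : T}

lemma orbit (hiso : IsometricAction G T) (h : CutPair H z a b) (K : MulAction.orbit G H) :
    CutPair (K : Set G) z (orbitRep K • a) (orbitRep K • b) := by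
  have := h.smul hiso (orbitRep K)
  rwa [orbitRep_smul] at this

variable (hT : TreeLike T) (hiso : IsometricAction G T) (hd : Dense (minSubtree G T))
  (h : CutPair H z a b)
include hT hiso hd h

lemma orbitHeight_smul (γ : G) (K : MulAction.orbit G H) (x : T) :
    orbitHeight a b (γ • K) (γ • x) = orbitHeight a b K x := by
  have hfix : ((orbitRep (γ • K))⁻¹ * (γ * orbitRep K)) • H = H := by
    rw [mul_smul, mul_smul, orbitRep_smul, inv_smul_eq_iff, orbitRep_smul]
    rfl
  obtain ⟨ha, hb⟩ := h.smul_eq hT hiso hd hfix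
  rw [mul_smul, inv_smul_eq_iff, mul_smul] at ha hb
  rw [orbitHeight, ← ha, ← hb, height_smul hiso, orbitHeight]

lemma sum_le (F : Finset (MulAction.orbit G H)) (x y : T) :
    ∑ K ∈ F, |orbitHeight a b K x - orbitHeight a b K y| ≤ 2 / dist a b * dist x y := by
  classical
  have hpos := dist_pos.mpr h.ne
  have half : ∀ F : Finset (MulAction.orbit G H),
      (∀ K ∈ F, ∀ K' ∈ F, (K' : Set G) ≠ (K : Set G)ᶜ) →
      ∑ K ∈ F, |orbitHeight a b K x - orbitHeight a b K y| ≤ dist x y / dist a b := by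
    intro F hF
    have := hT.sum_abs_height_le (fun K : MulAction.orbit G H => orbitRep K • a)
      (fun K => orbitRep K • b) (fun K => (h.orbit hiso K).ne) F
      (fun K hK K' hK' hne => (h.orbit hiso K).height_eq_height hT hiso hd (h.orbit hiso K')
        (fun e => hne (Subtype.ext e.symm)) (hF K hK K' hK')) x y
    simp only [hiso _ a b, ← Finset.mul_sum] at this
    rw [le_div_iff₀ hpos, mul_comm]
    exact this
  have h1 := half (F.filter fun K => (1 : G) ∈ (K : Set G)) fun K hK K' hK' e => by
    simp only [Finset.mem_filter] at hK hK'
    rw [e] at hK'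
    exact hK'.2 hK.2
  have h2 := half (F.filter fun K => ¬ (1 : G) ∈ (K : Set G)) fun K hK K' hK' e => by
    simp only [Finset.mem_filter] at hK hK'
    rw [e] at hK'
    exact hK'.2 hK.2
  rw [← Finset.sum_filter_add_sum_filter_not F fun K => (1 : G) ∈ (K : Set G)]
  calc _ ≤ dist x y / dist a b + dist x y / dist a b := add_le_add h1 h2
    _ = _ := by ring

lemma summable (x y : T) : Summable fun K : MulAction.orbit G H =>
    |orbitHeight a b K x - orbitHeight a b K y| :=
  summable_of_sum_le (fun _ => abs_nonneg _) fun F => h.sum_le hT hiso hd F x y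

lemma cutDist_le (x y : T) : cutDist H a b x y ≤ 2 / dist a b * dist x y :=
  Real.tsum_le_of_sum_le (fun _ => abs_nonneg _) fun F => h.sum_le hT hiso hd F x y

lemma abs_sub_le_cutDist (K : MulAction.orbit G H) (x y : T) :
    |orbitHeight a b K x - orbitHeight a b K y| ≤ cutDist H a b x y :=
  (h.summable hT hiso hd x y).le_tsum K fun _ _ => abs_nonneg _

lemma cutDist_triangle (x y w : T) :
    cutDist H a b x w ≤ cutDist H a b x y + cutDist H a b y w := by
  rw [cutDist, cutDist, cutDist,
    ← (h.summable hT hiso hd x y).tsum_add (h.summable hT hiso hd y w)]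
  exact (h.summable hT hiso hd x w).tsum_le_tsum (fun K => abs_sub_le _ _ _)
    ((h.summable hT hiso hd x y).add (h.summable hT hiso hd y w))

lemma cutDist_add {x y p : T} (hp : p ∈ seg x y) :
    cutDist H a b x p + cutDist H a b p y = cutDist H a b x y := by
  rw [cutDist, cutDist, cutDist,
    ← (h.summable hT hiso hd x p).tsum_add (h.summable hT hiso hd p y)]
  exact tsum_congr fun K => hT.abs_height_add _ _ hp

lemma cutDist_smul (γ : G) (x y : T) :
    cutDist H a b (γ • x) (γ • y) = cutDist H a b x y := by
  rw [cutDist, cutDist, ← (MulAction.toPerm γ : Equiv.Perm (MulAction.orbit G H)).tsum_eq]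
  exact tsum_congr fun K => by
    rw [MulAction.toPerm_apply, h.orbitHeight_smul hT hiso hd, h.orbitHeight_smul hT hiso hd]

end CutPair

end CutPair

section CutPairGeometry

variable {G T : Type*} [Group G] [MetricSpace T] [MulAction G T]

lemma TreeLike.eventually_height_eq (hT : TreeLike T) {a b x : T} (hab : a ≠ b)
    (h : height a b x = 0 ∨ height a b x = 1) (ha : x ≠ a) (hb : x ≠ b) :
    ∀ᶠ y in 𝓝 x, height a b y = height a b x := by
  have key : ∀ c e : T, x ≠ c → c ∈ seg e x → ∀ᶠ y in 𝓝 x, c ∈ seg e y := fun c e hc hce => by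
    filter_upwards [(isOpen_dir c x).mem_nhds (self_mem_dir hc)] with y hy
    exact (hT.mem_seg_or hce y).resolve_right fun h => hy (seg_comm y x ▸ h)
  rcases h with h | h <;> rw [h]
  · filter_upwards [key b a hb ((height_eq_zero_iff hab).mp h)] with y hy
    exact (height_eq_zero_iff hab).mpr hy
  · filter_upwards [key a b ha ((height_eq_one_iff hab).mp h)] with y hy
    exact (height_eq_one_iff hab).mpr hy

lemma eq_of_abs_sub_lt_one {s t : ℝ} (hs : s = 0 ∨ s = 1) (ht : t = 0 ∨ t = 1)
    (h : |s - t| < 1) : s = t := by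
  rcases hs with rfl | rfl <;> rcases ht with rfl | rfl <;> norm_num at *

lemma height_eq_div_of_mem_seg {a b x : T} (hx : x ∈ seg a b) :
    height a b x = dist x b / dist a b := by
  rw [mem_seg, dist_comm a x] at hx
  rw [height, show dist x b - dist x a + dist a b = 2 * dist x b by linarith]
  exact mul_div_mul_left _ _ two_ne_zero

namespace CutPair

variable {H : Set G} {z a b : T}

section

variable (hT : TreeLike T) (hiso : IsometricAction G T) (hd : Dense (minSubtree G T))
  (h : CutPair H z a b)
include hT hiso hd h

lemma mem_seg_of_height {x : T} (h0 : height a b x ≠ 0) (h1 : height a b x ≠ 1) :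
    x ∈ seg a b := by
  obtain ⟨m, m1, m2, m3⟩ := hT.exists_median x a b
  rcases eq_or_ne x m with rfl | hxm
  · exact m3
  exfalso
  have hma : m ≠ a := by
    rintro rfl
    exact h1 ((height_eq_one_iff h.ne).mpr (seg_comm x b ▸ m2))
  have hmb : m ≠ b := by
    rintro rfl
    exact h0 ((height_eq_zero_iff h.ne).mpr (seg_comm x a ▸ m1))
  obtain ⟨g, hg⟩ := exists_smul_mem_dir hT hiso hd hxm z
  apply hg
  by_cases hgH : g ∈ H
  · rw [seg_comm] at m3
    exact (hT.mem_seg_chain m1 (mem_seg_right_of_left (h.left g hgH) m3) hma).1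
  · exact (hT.mem_seg_chain m2 (mem_seg_right_of_left (h.right g hgH) m3) hmb).1

lemma eq_of_height_eq {x y : T} (h0 : height a b x ≠ 0) (h1 : height a b x ≠ 1)
    (hxy : height a b x = height a b y) : x = y := by
  have hx := h.mem_seg_of_height hT hiso hd h0 h1
  have hy := h.mem_seg_of_height hT hiso hd (hxy ▸ h0) (hxy ▸ h1)
  rw [height_eq_div_of_mem_seg hx, height_eq_div_of_mem_seg hy,
    div_left_inj' (dist_pos.mpr h.ne).ne'] at hxy
  rw [seg_comm] at hx hy
  refine hT.eq_of_dist_eq hx hy ?_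
  rwa [dist_comm b x, dist_comm b y]

lemma mem_seg_of_height_le {u v m : T} (h0 : height a b m ≠ 0) (h1 : height a b m ≠ 1)
    (hu : height a b u ≤ height a b m) (hv : height a b m ≤ height a b v) : m ∈ seg u v := by
  obtain ⟨p, hp, hpm⟩ := (hT.isPreconnected_seg u v).intermediate_value (left_mem_seg u v)
    (right_mem_seg u v) (continuous_height a b).continuousOn ⟨hu, hv⟩
  rwa [h.eq_of_height_eq hT hiso hd h0 h1 hpm.symm]

/-- Some element translates a point along its axis and moves its height. -/
lemma exists_translation : ∃ (g : G) (m : T), g • m ∈ seg m (g • g • m) ∧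
    height a b (g • m) ≠ height a b m := by
  obtain ⟨m, hm, hmd⟩ := hT.exists_mem_seg b a (t := dist a b / 2) (by positivity)
    (by linarith [dist_comm a b, dist_nonneg (x := a) (y := b)])
  have hpos := dist_pos.mpr h.ne
  have hhm : height a b m = 1 / 2 := by
    rw [height_eq_div_of_mem_seg (seg_comm b a ▸ hm), dist_comm, hmd]
    field_simp
  have hma : a ≠ m := by
    rintro rfl
    linarith [dist_comm a b]
  have hmb : b ≠ m := by
    rintro rfl
    rw [dist_self] at hmd
    linarith
  have h0 : height a b m ≠ 0 := by norm_num [hhm]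
  have h1 : height a b m ≠ 1 := by norm_num [hhm]
  have hne : ∀ x, x ≠ m → height a b x < 1 / 2 ∨ 1 / 2 < height a b x := fun x hx =>
    lt_or_gt_of_ne fun e => hx (h.eq_of_height_eq hT hiso hd h0 h1 (hhm.trans e.symm)).symm
  have hseg : ∀ {x y : T}, height a b x < 1 / 2 → 1 / 2 < height a b y → m ∈ seg x y :=
    fun hx hy => h.mem_seg_of_height_le hT hiso hd h0 h1 (hhm ▸ hx.le) (hhm ▸ hy.le)
  have htrans : ∀ g : G, m ∈ seg (g⁻¹ • m) (g • m) → g • m ∈ seg m (g • g • m) := by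
    intro g hg
    simpa using (smul_mem_seg hiso g).mpr hg
  obtain ⟨u, hu⟩ := exists_smul_mem_dir hT hiso hd hma m
  obtain ⟨w, hw⟩ := exists_smul_mem_dir hT hiso hd hmb m
  have hu : 1 / 2 < height a b (u • m) := by
    have hum : u • m ≠ m := ne_of_mem_dir hu
    refine (hne _ hum).resolve_left fun hlt => hu ?_
    rw [seg_comm]
    refine hseg hlt ?_
    rw [(height_eq_one_iff h.ne).mpr (right_mem_seg b a)]
    norm_num
  have hw : height a b (w • m) < 1 / 2 := by
    have hwm : w • m ≠ m := ne_of_mem_dir hw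
    refine (hne _ hwm).resolve_right fun hlt => hw (hseg ?_ hlt)
    rw [(height_eq_zero_iff h.ne).mpr (right_mem_seg a b)]
    norm_num
  have hum : u⁻¹ • m ≠ m := fun e => by
    rw [inv_smul_eq_iff] at e
    rw [← e, hhm] at hu
    exact lt_irrefl _ hu
  have hwm : w⁻¹ • m ≠ m := fun e => by
    rw [inv_smul_eq_iff] at e
    rw [← e, hhm] at hw
    exact lt_irrefl _ hw
  rcases hne _ hum with hu' | hu'
  · exact ⟨u, m, htrans u (hseg hu' hu), by rw [hhm]; exact hu.ne'⟩
  rcases hne _ hwm with hw' | hw'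
  · have hm' := hseg hw hu'
    have k1 : 1 / 2 < height a b ((u * w) • m) := by
      have e : u • m ∈ seg ((u * w) • m) m := by
        simpa [mul_smul] using (smul_mem_seg hiso u).mpr hm'
      rcases hT.height_mono a b e with k | k <;> linarith
    have k2 : height a b ((u * w)⁻¹ • m) < 1 / 2 := by
      have e : w⁻¹ • m ∈ seg m ((u * w)⁻¹ • m) := by
        simpa [mul_smul] using (smul_mem_seg hiso w⁻¹).mpr hm'
      rcases hT.height_mono a b e with k | k <;> linarith
    exact ⟨u * w, m, htrans _ (hseg k2 k1), by rw [hhm]; exact k1.ne'⟩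
  · exact ⟨w, m, htrans w (seg_comm (w • m) _ ▸ hseg hw hw'), by rw [hhm]; exact hw.ne⟩

/-- Every point is at zero distance from a segment between two translates of `z`. -/
lemma exists_mem_seg_orbit (x : T) : ∃ (y : T) (g g' : G), cutDist H a b x y = 0 ∧
    y ∈ seg (g • z) (g' • z) := by
  by_cases hx : ∃ g g' : G, x ∈ seg (g • z) (g' • z)
  · obtain ⟨g, g', hx⟩ := hx
    exact ⟨x, g, g', by simp [cutDist], hx⟩
  push Not at hx
  have hhull : ∀ K : MulAction.orbit G H, x ∉ seg (orbitRep K • a) (orbitRep K • b) := by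
    intro K hK
    have c := h.orbit hiso K
    obtain ⟨g, hg⟩ := c.nonempty hT hiso hd
    obtain ⟨g', hg'⟩ := c.exists_notMem hT hiso hd
    obtain ⟨h1, h2⟩ := c.mem_seg hT hg hg'
    exact hx g g' (hT.seg_subset h1 h2 hK)
  have hK : ∀ K : MulAction.orbit G H, orbitHeight a b K x = 0 ∨ orbitHeight a b K x = 1 := by
    intro K
    by_contra! hcon
    exact hhull K ((h.orbit hiso K).mem_seg_of_height hT hiso hd hcon.1 hcon.2)
  have hz : ∀ K : MulAction.orbit G H, orbitHeight a b K z = 0 ∨ orbitHeight a b K z = 1 := by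
    intro K
    by_cases h1 : (1 : G) ∈ (K : Set G)
    · exact .inr (by simpa [orbitHeight] using (h.orbit hiso K).height_of_mem h1)
    · exact .inl (by simpa [orbitHeight] using (h.orbit hiso K).height_of_notMem h1)
  have hfin : {K : MulAction.orbit G H | orbitHeight a b K z ≠ orbitHeight a b K x}.Finite := by
    have := (h.summable hT hiso hd z x).tendsto_cofinite_zero.eventually_lt_const one_pos
    refine Set.Finite.subset this fun K hne hlt => hne ?_
    exact eq_of_abs_sub_lt_one (hz K) (hK K) hlt
  have hev : ∀ᶠ y in 𝓝 x, ∀ K ∈ {K : MulAction.orbit G H |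
      orbitHeight a b K z ≠ orbitHeight a b K x}, orbitHeight a b K y = orbitHeight a b K x := by
    rw [eventually_all_finite hfin]
    intro K _
    exact hT.eventually_height_eq (h.orbit hiso K).ne (hK K)
      (fun e => hhull K (e ▸ left_mem_seg _ _)) (fun e => hhull K (e ▸ right_mem_seg _ _))
  obtain ⟨ε, hε, hball⟩ := Metric.eventually_nhds_iff.mp hev
  have hxz : x ≠ z := by
    rintro rfl
    exact hx 1 1 (by simpa using left_mem_seg x x)
  have hpos := dist_pos.mpr hxz
  obtain ⟨y, hy, hyd⟩ := hT.exists_mem_seg x z (t := min (ε / 2) (dist x z))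
    (by positivity) (min_le_right _ _)
  have hyx : x ≠ y := by
    apply dist_pos.mp
    rw [hyd]
    positivity
  have hheight : ∀ K : MulAction.orbit G H, orbitHeight a b K x = orbitHeight a b K y := by
    intro K
    by_cases hKz : orbitHeight a b K z = orbitHeight a b K x
    · exact (hT.height_eq_of_mem_seg hKz.symm hy).symm
    · refine (hball ?_ K hKz).symm
      rw [dist_comm, hyd]
      exact (min_le_left _ _).trans_lt (by linarith)
  obtain ⟨g, hg⟩ := exists_smul_mem_dir hT hiso hd hyx z
  refine ⟨y, g, 1, by simp [cutDist, hheight], ?_⟩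
  rw [one_smul]
  exact (hT.mem_seg_or hy (g • z)).resolve_left hg

lemma abs_orbitHeight_add {x y p : T}
    (hp : cutDist H a b x p + cutDist H a b p y = cutDist H a b x y)
    (K : MulAction.orbit G H) :
    |orbitHeight a b K x - orbitHeight a b K p| + |orbitHeight a b K p - orbitHeight a b K y| =
      |orbitHeight a b K x - orbitHeight a b K y| := by
  have s1 := (h.summable hT hiso hd x p).hasSum
  have s2 := (h.summable hT hiso hd p y).hasSum
  have s3 := (h.summable hT hiso hd x y).hasSum
  have s := (s1.add s2).sub s3
  rw [← cutDist, ← cutDist, ← cutDist, hp, sub_self,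
    hasSum_zero_iff_of_nonneg fun K => by
      rw [sub_nonneg]
      exact abs_sub_le _ _ _] at s
  exact sub_eq_zero.mp (congrFun s K)

end

lemma cutDist_orbit_eq {T' : Type*} [MetricSpace T'] [MulAction G T'] {z' a' b' : T'}
    (hiso : IsometricAction G T) (hiso' : IsometricAction G T') (h : CutPair H z a b)
    (h' : CutPair H z' a' b') (g g' : G) :
    cutDist H a b (g • z) (g' • z) = cutDist H a' b' (g • z') (g' • z') := by
  have key : ∀ (K : MulAction.orbit G H) (g : G),
      orbitHeight a b K (g • z) = orbitHeight a' b' K (g • z') := by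
    intro K g
    by_cases hg : g ∈ (K : Set G)
    · exact ((h.orbit hiso K).height_of_mem hg).trans
        ((h'.orbit hiso' K).height_of_mem hg).symm
    · exact ((h.orbit hiso K).height_of_notMem hg).trans
        ((h'.orbit hiso' K).height_of_notMem hg).symm
  exact tsum_congr fun K => by rw [key, key]

end CutPair

end CutPairGeometry

section TreePseudoDist

/-- An invariant pseudo-distance on a tree, additive along segments. -/
structure TreePseudoDist (G : Type*) {T : Type*} [Group G] [MetricSpace T] [MulAction G T]
    (D : T → T → ℝ) : Prop where
  self : ∀ x, D x x = 0
  comm : ∀ x y, D x y = D y x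
  triangle : ∀ x y z, D x z ≤ D x y + D y z
  add : ∀ x y, ∀ p ∈ seg x y, D x p + D p y = D x y
  bound : ∃ C, ∀ x y, D x y ≤ C * dist x y
  smul : ∀ (g : G) (x y : T), D (g • x) (g • y) = D x y

namespace TreePseudoDist

variable {G T : Type*} [Group G] [MetricSpace T] [MulAction G T] {D : T → T → ℝ}

section

variable (h : TreePseudoDist G D)
include h

lemma nonneg (x y : T) : 0 ≤ D x y := by
  linarith [h.self x, h.comm x y, h.triangle x y x]

lemma eq_of_eq_zero {x y : T} (hxy : D x y = 0) (z : T) : D x z = D y z := by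
  linarith [h.comm x y, h.triangle x y z, h.triangle y x z]

lemma continuous_right (x : T) : Continuous (D x) := by
  obtain ⟨C, hC⟩ := h.bound
  refine (LipschitzWith.of_dist_le' (K := C) fun p q => ?_).continuous
  rw [Real.dist_eq, abs_sub_le_iff]
  have := hC p q
  have := h.comm p q
  constructor <;> linarith [h.triangle x q p, h.triangle x p q]

lemma exists_mem_seg (hT : TreeLike T) (x y : T) {t : ℝ} (h0 : 0 ≤ t) (h1 : t ≤ D x y) :
    ∃ p ∈ seg x y, D x p = t := by
  obtain ⟨p, hp, hpt⟩ := (hT.isPreconnected_seg x y).intermediate_value (left_mem_seg x y)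
    (right_mem_seg x y) (h.continuous_right x).continuousOn ⟨(h.self x).symm ▸ h0, h1⟩
  exact ⟨p, hp, hpt⟩

lemma eq_abs_sub (hT : TreeLike T) {x y p q : T} (hp : p ∈ seg x y) (hq : q ∈ seg x y) :
    D p q = |D x p - D x q| := by
  rcases le_total (dist x p) (dist x q) with hle | hle
  · have := h.add _ _ _ (hT.dist_of_mem_seg hp hq hle)
    rw [abs_of_nonpos] <;> linarith [h.nonneg p q]
  · have := h.add _ _ _ (hT.dist_of_mem_seg hq hp hle)
    rw [h.comm, abs_of_nonneg] <;> linarith [h.nonneg q p]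

/-- The distances to the endpoints of a segment determine the distances to a point of it. -/
lemma eq_max (hT : TreeLike T) {p q y : T} (hy : y ∈ seg p q) (e : T) :
    D y e = max (D p e - D p y) (D q e - D y q) := by
  have t1 := h.triangle p y e
  have t2 := h.triangle q y e
  have c := h.comm q y
  apply le_antisymm _ (max_le (by linarith) (by linarith))
  rcases hT.mem_seg_or hy e with hs | hs
  · exact le_max_of_le_left (by linarith [h.add _ _ _ hs])
  · exact le_max_of_le_right (by linarith [h.add _ _ _ hs, h.comm e y, h.comm e q])

end

/-- The relation of being at zero pseudo-distance. -/
def setoid (h : TreePseudoDist G D) : Setoid T where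
  r x y := D x y = 0
  iseqv := ⟨h.self, fun {x y} e => by rw [h.comm, e],
    fun {x y z} e e' => by rw [h.eq_of_eq_zero e, e']⟩

/-- The metric quotient of a tree by a pseudo-distance. -/
def Quot (h : TreePseudoDist G D) : Type _ := Quotient h.setoid

/-- The quotient map. -/
def proj (h : TreePseudoDist G D) (x : T) : h.Quot := Quotient.mk h.setoid x

lemma surjective_proj (h : TreePseudoDist G D) : Surjective h.proj := Quotient.mk_surjective

instance (h : TreePseudoDist G D) : MetricSpace h.Quot where
  dist := Quotient.lift₂ D fun x y x' y' e e' => by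
    rw [h.eq_of_eq_zero e, h.comm, h.eq_of_eq_zero e', h.comm]
  dist_self := by
    rintro ⟨x⟩
    exact h.self x
  dist_comm := by
    rintro ⟨x⟩ ⟨y⟩
    exact h.comm x y
  dist_triangle := by
    rintro ⟨x⟩ ⟨y⟩ ⟨z⟩
    exact h.triangle x y z
  eq_of_dist_eq_zero := by
    rintro ⟨x⟩ ⟨y⟩ e
    exact Quotient.sound e

lemma dist_proj (h : TreePseudoDist G D) (x y : T) : dist (h.proj x) (h.proj y) = D x y := rfl

instance (h : TreePseudoDist G D) : MulAction G h.Quot where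
  smul g := Quotient.map (g • ·) fun x y e => (h.smul g x y).trans e
  one_smul := by
    rintro ⟨x⟩
    exact congrArg h.proj (one_smul G x)
  mul_smul g g' := by
    rintro ⟨x⟩
    exact congrArg h.proj (mul_smul g g' x)

lemma proj_smul (h : TreePseudoDist G D) (g : G) (x : T) : h.proj (g • x) = g • h.proj x := rfl

variable (h : TreePseudoDist G D)

lemma proj_eq_proj {x y : T} : h.proj x = h.proj y ↔ D x y = 0 := by
  rw [← dist_eq_zero, dist_proj]

lemma isometricAction_quot : IsometricAction G h.Quot := by
  intro g p q
  obtain ⟨x, rfl⟩ := h.surjective_proj p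
  obtain ⟨y, rfl⟩ := h.surjective_proj q
  exact h.smul g x y

lemma isRefinementMap_proj : IsRefinementMap G h.proj := by
  refine ⟨?_, h.surjective_proj, fun p x y hp => h.add x y p hp, fun g x => rfl⟩
  obtain ⟨C, hC⟩ := h.bound
  exact (LipschitzWith.of_dist_le' (K := C) hC).continuous

lemma treeLike_quot (hT : TreeLike T) : TreeLike h.Quot := by
  constructor
  · intro p q
    obtain ⟨x, rfl⟩ := h.surjective_proj p
    obtain ⟨y, rfl⟩ := h.surjective_proj q
    rw [dist_proj]
    have : Nonempty T := ⟨x⟩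
    choose! f hf hfd using fun t (ht : t ∈ Icc 0 (D x y)) =>
      h.exists_mem_seg hT x y ht.1 ht.2
    have hmem0 : (0 : ℝ) ∈ Icc 0 (D x y) := ⟨le_rfl, h.nonneg x y⟩
    have hmem1 : D x y ∈ Icc 0 (D x y) := ⟨h.nonneg x y, le_rfl⟩
    refine ⟨fun t => h.proj (f t), ?_, ?_, fun s hs t ht => ?_⟩
    · rw [proj_eq_proj, h.comm]
      exact hfd 0 hmem0
    · rw [proj_eq_proj]
      linarith [h.add _ _ _ (hf _ hmem1), hfd _ hmem1]
    · rw [dist_proj, h.eq_abs_sub hT (hf s hs) (hf t ht), hfd s hs, hfd t ht]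
  · intro p q r s
    obtain ⟨x, rfl⟩ := h.surjective_proj p
    obtain ⟨y, rfl⟩ := h.surjective_proj q
    obtain ⟨z, rfl⟩ := h.surjective_proj r
    obtain ⟨w, rfl⟩ := h.surjective_proj s
    simp only [dist_proj]
    obtain ⟨m, hm1, hm2, hm3⟩ := hT.exists_median x y z
    obtain ⟨n, hn1, hn2, hn3⟩ := hT.exists_median x y w
    have t1 := h.triangle z m w
    have t2 := h.triangle m n w
    have e1 := h.comm z m
    have e2 := h.comm m y
    have e3 := h.comm n y
    have e4 := h.comm y z
    have a1 := h.add _ _ _ hm1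
    have a2 := h.add _ _ _ hm2
    have a3 := h.add _ _ _ hm3
    have b1 := h.add _ _ _ hn1
    have b2 := h.add _ _ _ hn2
    have b3 := h.add _ _ _ hn3
    rcases le_total (dist x m) (dist x n) with hle | hle
    · have := h.add _ _ _ (hT.dist_of_mem_seg hm1 hn1 hle)
      right; linarith
    · have := h.add _ _ _ (hT.dist_of_mem_seg hn1 hm1 hle)
      rw [h.comm] at this
      left; linarith [h.comm x n, h.comm n m]

end TreePseudoDist

end TreePseudoDist

section Transport

/-- A tree with a pseudo-distance which is the hull of an orbit refines any tree which is the hull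
of an orbit with the same mutual distances. -/
lemma TreePseudoDist.exists_isRefinementMap {G T X : Type*} [Group G] [MetricSpace T]
    [MetricSpace X] [MulAction G T] [MulAction G X] (hT : TreeLike T) (hX : TreeLike X)
    (hiso : IsometricAction G X) {D : T → T → ℝ} (h : TreePseudoDist G D) {w : T} {v : X}
    (hdist : ∀ g g' : G, D (g • w) (g' • w) = dist (g • v) (g' • v))
    (hw : ∀ y, ∃ (y' : T) (g g' : G), D y y' = 0 ∧ y' ∈ seg (g • w) (g' • w))
    (hv : ∀ x : X, ∃ g g' : G, x ∈ seg (g • v) (g' • v)) :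
    ∃ f : T → X, IsRefinementMap G f := by
  have hmaxX : ∀ {p q x : X}, x ∈ seg p q → ∀ e,
      dist x e = max (dist p e - dist p x) (dist q e - dist x q) := by
    intro p q x hx e
    have t1 := dist_triangle p x e
    have t2 := dist_triangle q x e
    have c := dist_comm q x
    apply le_antisymm _ (max_le (by linarith) (by linarith))
    rcases hX.mem_seg_or hx e with hs | hs <;> rw [mem_seg] at hs
    · exact le_max_of_le_left (by linarith)
    · exact le_max_of_le_right (by linarith [dist_comm e x, dist_comm e q])
  have hf : ∀ y, ∃ x : X, ∀ g : G, dist x (g • v) = D y (g • w) := by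
    intro y
    obtain ⟨y', g, g', hyy', hy'⟩ := hw y
    obtain ⟨x, hx, hxd⟩ := hX.exists_mem_seg (g • v) (g' • v) (h.nonneg (g • w) y') (by
      rw [← hdist, ← h.add _ _ _ hy']
      linarith [h.nonneg y' (g' • w)])
    refine ⟨x, fun k => ?_⟩
    have hxd' : dist x (g' • v) = D y' (g' • w) := by
      rw [mem_seg, ← hdist, ← h.add _ _ _ hy'] at hx
      linarith
    rw [h.eq_of_eq_zero hyy', h.eq_max hT hy', hmaxX hx, hdist, hdist, hxd, hxd']
  choose f hf using hf
  have huniq : ∀ x x' : X, (∀ g : G, dist x (g • v) = dist x' (g • v)) → x = x' := by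
    intro x x' hxx'
    obtain ⟨g, g', hx⟩ := hv x
    rw [← dist_eq_zero, hmaxX hx, dist_comm _ x', dist_comm _ x', ← hxx', ← hxx', dist_comm,
      sub_self, sub_self, max_self]
  have hfd : ∀ y u, dist (f y) (f u) = D y u := by
    intro y u
    obtain ⟨y', g, g', hyy', hy'⟩ := hw y
    have hfy : f y ∈ seg (g • v) (g' • v) := by
      rw [mem_seg, dist_comm, hf, hf, h.comm, ← hdist, h.comm, h.eq_of_eq_zero hyy',
        h.eq_of_eq_zero hyy', h.comm, h.add _ _ _ hy']
    rw [h.eq_of_eq_zero hyy', h.eq_max hT hy', hmaxX hfy, dist_comm _ (f u), dist_comm _ (f u),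
      dist_comm _ (f y), hf, hf, hf, hf, h.comm u, h.comm u, h.eq_of_eq_zero hyy',
      h.eq_of_eq_zero hyy', h.comm y']
  refine ⟨f, ?_, ?_, ?_, ?_⟩
  · obtain ⟨C, hC⟩ := h.bound
    refine (LipschitzWith.of_dist_le' (K := C) fun y u => ?_).continuous
    rw [hfd]
    exact hC y u
  · intro x
    obtain ⟨g, g', hx⟩ := hv x
    obtain ⟨y, hy, hyd⟩ := h.exists_mem_seg hT (g • w) (g' • w)
      (dist_nonneg (x := g • v) (y := x)) (by
        rw [hdist]
        exact dist_le_of_mem_seg hx)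
    refine ⟨y, huniq _ _ fun k => ?_⟩
    have hyd' : D y (g' • w) = dist x (g' • v) := by
      have := h.add _ _ _ hy
      rw [hdist] at this
      rw [mem_seg] at hx
      linarith
    rw [hf, h.eq_max hT hy, hmaxX hx, hdist, hdist, hyd, hyd']
  · intro p x y hp
    rw [mem_seg, hfd, hfd, hfd]
    exact h.add x y p hp
  · intro g y
    refine huniq _ _ fun k => ?_
    rw [hf, ← h.smul g⁻¹, inv_smul_smul, smul_smul, ← hf, ← hiso g (f y), smul_smul,
      mul_inv_cancel_left]

end Transport

section Simplicial

lemma TreeLike.finite_seg_inter {X : Type*} [MetricSpace X] (hX : TreeLike X) {V : Set X}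
    (hV : ∀ v ∈ V, ∀ w ∈ V, dist v w < 1 → v = w) (x y : X) : (seg x y ∩ V).Finite := by
  refine Set.Finite.of_injOn (f := fun p => ⌊dist x p⌋) (t := Icc 0 ⌊dist x y⌋)
    (fun p hp => ⟨Int.floor_nonneg.mpr dist_nonneg,
      Int.floor_le_floor (dist_le_of_mem_seg hp.1)⟩) (fun p hp q hq hpq => ?_)
    (Set.finite_Icc _ _)
  refine hV p hp.2 q hq.2 ?_
  have hlt := Int.abs_sub_lt_one_of_floor_eq_floor hpq
  rcases le_total (dist x p) (dist x q) with hle | hle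
  · have := hX.dist_of_mem_seg hp.1 hq.1 hle
    rw [mem_seg] at this
    rw [abs_lt] at hlt
    linarith
  · have := hX.dist_of_mem_seg hq.1 hp.1 hle
    rw [mem_seg, dist_comm q] at this
    rw [abs_lt] at hlt
    linarith

variable {G T : Type*} [Group G] [MetricSpace T] [MulAction G T]

/-- The points at which no height takes an intermediate value. -/
def cutVertices (H : Set G) (a b : T) : Set T :=
  {x | ∀ K : MulAction.orbit G H, orbitHeight a b K x = 0 ∨ orbitHeight a b K x = 1}

namespace CutPair

variable {H : Set G} {z a b : T}

section

variable (hT : TreeLike T) (hiso : IsometricAction G T) (hd : Dense (minSubtree G T))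
  (h : CutPair H z a b)
include hT hiso hd h

lemma treePseudoDist : TreePseudoDist G (cutDist H a b) where
  self x := by simp [cutDist]
  comm x y := tsum_congr fun K => abs_sub_comm _ _
  triangle := h.cutDist_triangle hT hiso hd
  add x y p hp := h.cutDist_add hT hiso hd hp
  bound := ⟨_, h.cutDist_le hT hiso hd⟩
  smul := h.cutDist_smul hT hiso hd

lemma cutDist_eq_zero_iff {x y : T} : cutDist H a b x y = 0 ↔
    ∀ K : MulAction.orbit G H, orbitHeight a b K x = orbitHeight a b K y := by
  constructor
  · intro e K
    have := h.abs_sub_le_cutDist hT hiso hd K x y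
    rw [e] at this
    exact sub_eq_zero.mp (abs_nonpos_iff.mp this)
  · intro e
    simp [cutDist, e]

lemma smul_mem_cutVertices {x : T} (hx : x ∈ cutVertices H a b) (g : G) :
    g • x ∈ cutVertices H a b := by
  intro K
  have := h.orbitHeight_smul hT hiso hd g (g⁻¹ • K) x
  rw [smul_inv_smul] at this
  rw [this]
  exact hx _

lemma isSimplicialStructure : IsSimplicialStructure
    ((h.treePseudoDist hT hiso hd).proj '' cutVertices H a b) := by
  set P := h.treePseudoDist hT hiso hd
  have hX := P.treeLike_quot hT
  have hdisc : ∀ v ∈ P.proj '' cutVertices H a b, ∀ w ∈ P.proj '' cutVertices H a b,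
      dist v w < 1 → v = w := by
    rintro _ ⟨x, hx, rfl⟩ _ ⟨y, hy, rfl⟩ hlt
    rw [P.proj_eq_proj, h.cutDist_eq_zero_iff hT hiso hd]
    exact fun K => eq_of_abs_sub_lt_one (hx K) (hy K)
      ((h.abs_sub_le_cutDist hT hiso hd K x y).trans_lt hlt)
  refine ⟨fun p hp => ?_, hX.finite_seg_inter hdisc, fun v hv =>
    ⟨1, one_pos, fun w hw hlt => (hdisc v hv w hw hlt).symm⟩⟩
  obtain ⟨x, rfl⟩ := P.surjective_proj p
  by_contra hx
  have hx : x ∉ cutVertices H a b := fun hx' => hx ⟨x, hx', rfl⟩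
  simp only [cutVertices, Set.mem_ofPred_eq, not_forall, not_or] at hx
  obtain ⟨K, hK0, hK1⟩ := hx
  have hside : ∀ y : T, P.proj y ≠ P.proj x →
      orbitHeight a b K x < orbitHeight a b K y ∨ orbitHeight a b K y < orbitHeight a b K x := by
    intro y hy
    refine lt_or_gt_of_ne fun e => hy ?_
    rw [(h.orbit hiso K).eq_of_height_eq hT hiso hd hK0 hK1 e]
  have hdir : ∀ y y' : T, 0 < (orbitHeight a b K y - orbitHeight a b K x) *
      (orbitHeight a b K y' - orbitHeight a b K x) →
      dir (P.proj x) (P.proj y) = dir (P.proj x) (P.proj y') := by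
    intro y y' hpos
    refine (hX.dir_eq_of_mem (w := P.proj y') fun hmem => ?_).symm
    have := h.abs_orbitHeight_add hT hiso hd hmem K
    rw [← sub_add_sub_cancel (orbitHeight a b K y) (orbitHeight a b K x)
      (orbitHeight a b K y'), eq_comm, abs_add_eq_add_abs_iff] at this
    rcases this with k | k <;> nlinarith
  obtain ⟨δ₁, δ₂, δ₃, h₁, h₂, h₃, h₁₂, h₁₃, h₂₃⟩ := hp
  obtain ⟨p₁, hp₁, rfl⟩ := hX.isDirectionAt_iff.mp h₁
  obtain ⟨p₂, hp₂, rfl⟩ := hX.isDirectionAt_iff.mp h₂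
  obtain ⟨p₃, hp₃, rfl⟩ := hX.isDirectionAt_iff.mp h₃
  obtain ⟨y₁, rfl⟩ := P.surjective_proj p₁
  obtain ⟨y₂, rfl⟩ := P.surjective_proj p₂
  obtain ⟨y₃, rfl⟩ := P.surjective_proj p₃
  have k₁₂ := not_lt.mp (mt (hdir y₁ y₂) h₁₂)
  have k₁₃ := not_lt.mp (mt (hdir y₁ y₃) h₁₃)
  have k₂₃ := not_lt.mp (mt (hdir y₂ y₃) h₂₃)
  rcases hside y₁ hp₁ with s₁ | s₁ <;> rcases hside y₂ hp₂ with s₂ | s₂ <;>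
    rcases hside y₃ hp₃ with s₃ | s₃ <;> nlinarith

lemma smul_image_cutVertices (g : G) :
    (fun p => g • p) '' ((h.treePseudoDist hT hiso hd).proj '' cutVertices H a b) =
      (h.treePseudoDist hT hiso hd).proj '' cutVertices H a b := by
  set P := h.treePseudoDist hT hiso hd
  apply Subset.antisymm
  · rintro _ ⟨_, ⟨x, hx, rfl⟩, rfl⟩
    exact ⟨g • x, h.smul_mem_cutVertices hT hiso hd hx g, rfl⟩
  · rintro _ ⟨x, hx, rfl⟩
    refine ⟨P.proj (g⁻¹ • x), ⟨_, h.smul_mem_cutVertices hT hiso hd hx _, rfl⟩, ?_⟩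
    simp only [← P.proj_smul, smul_inv_smul]

lemma nontrivialAction_quot :
    NontrivialAction G (h.treePseudoDist hT hiso hd).Quot := by
  set P := h.treePseudoDist hT hiso hd
  let K : MulAction.orbit G H := ⟨H, MulAction.mem_orbit_self H⟩
  obtain ⟨g, m, hm, hne⟩ := (h.orbit hiso K).exists_translation hT hiso hd
  have hm' : g • P.proj m ∈ seg (P.proj m) (g • g • P.proj m) :=
    P.isRefinementMap_proj.2.2.1 _ _ _ hm
  have hne' : g • P.proj m ≠ P.proj m := by
    rw [← P.proj_smul, Ne, P.proj_eq_proj, h.cutDist_eq_zero_iff hT hiso hd]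
    exact fun e => hne (e K)
  refine ⟨g, fun p hp => ?_⟩
  obtain ⟨n, hn⟩ := (eventually_dist_pow_smul (P.treeLike_quot hT) P.isometricAction_quot
    hm' hne' p p 0).exists
  rw [pow_smul_eq_of_smul_eq hp, dist_self] at hn
  exact lt_irrefl _ hn

end

end CutPair

/-- Two trees with corresponding cut pairs refine a common simplicial tree. -/
lemma refineCommonSimplicial_of_cutPair {T₁ T₂ : Type} {G : Type*} [Group G] [MetricSpace T₁]
    [MetricSpace T₂] [MulAction G T₁] [MulAction G T₂] (hT₁ : TreeLike T₁) (hT₂ : TreeLike T₂)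
    (hiso₁ : IsometricAction G T₁) (hiso₂ : IsometricAction G T₂)
    (hd₁ : Dense (minSubtree G T₁)) (hd₂ : Dense (minSubtree G T₂)) {H : Set G}
    {z₁ a₁ b₁ : T₁} {z₂ a₂ b₂ : T₂} (h₁ : CutPair H z₁ a₁ b₁) (h₂ : CutPair H z₂ a₂ b₂) :
    RefineCommonSimplicial G T₁ T₂ := by
  let P₁ := h₁.treePseudoDist hT₁ hiso₁ hd₁
  let P₂ := h₂.treePseudoDist hT₂ hiso₂ hd₂
  refine ⟨{ carrier := P₁.Quot
            isom := P₁.isometricAction_quot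
            tree := (P₁.treeLike_quot hT₁).isRTree
            V := P₁.proj '' cutVertices H a₁ b₁
            simp := h₁.isSimplicialStructure hT₁ hiso₁ hd₁
            inv := h₁.smul_image_cutVertices hT₁ hiso₁ hd₁ },
    h₁.nontrivialAction_quot hT₁ hiso₁ hd₁, ⟨P₁.proj, P₁.isRefinementMap_proj⟩, ?_⟩
  refine P₂.exists_isRefinementMap hT₂ (P₁.treeLike_quot hT₁) P₁.isometricAction_quot
    (w := z₂) (v := P₁.proj z₁) (fun g g' => (h₁.cutDist_orbit_eq hiso₁ hiso₂ h₂ g g').symm)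
    (h₂.exists_mem_seg_orbit hT₂ hiso₂ hd₂) fun p => ?_
  obtain ⟨x, rfl⟩ := P₁.surjective_proj p
  obtain ⟨y, g, g', hxy, hy⟩ := h₁.exists_mem_seg_orbit hT₁ hiso₁ hd₁ x
  refine ⟨g, g', ?_⟩
  rw [P₁.proj_eq_proj.mpr hxy]
  exact P₁.isRefinementMap_proj.2.2.1 _ _ _ hy

end Simplicial

section Facing

lemma mem_dir_of_dir_union_eq_univ {T : Type*} [MetricSpace T] {x y x' y' : T}
    (h : dir x y ∪ dir x' y' = univ) : x' ∈ dir x y :=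
  ((h ▸ mem_univ x' : x' ∈ dir x y ∪ dir x' y')).resolve_right (base_notMem_dir x' y')

lemma mem_seg_of_notMem_dir {T : Type*} [MetricSpace T] (hT : TreeLike T) {x y x' p : T}
    (h : x' ∈ dir x y) (hp : p ∉ dir x y) : x ∈ seg x' p := by
  rw [← hT.dir_eq_of_mem h] at hp
  exact notMem_dir.mp hp

/-- Facing light quadrants define corresponding cut pairs. -/
lemma HasFacingLightQuadrants.exists_cutPair {G T₁ T₂ : Type*} [Group G] [MetricSpace T₁]
    [MetricSpace T₂] [MulAction G T₁] [MulAction G T₂] (hT₁ : TreeLike T₁) (hT₂ : TreeLike T₂)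
    (hiso₁ : IsometricAction G T₁) (hiso₂ : IsometricAction G T₂)
    (hne : (Core G T₁ T₂).Nonempty) (h : HasFacingLightQuadrants G T₁ T₂) :
    ∃ (H : Set G) (z₁ a₁ b₁ : T₁) (z₂ a₂ b₂ : T₂), CutPair H z₁ a₁ b₁ ∧ CutPair H z₂ a₂ b₂ := by
  obtain ⟨x₁, y₁, x₁', y₁', x₂, y₂, x₂', y₂', hu₁, hu₂, hl, hl'⟩ := h
  obtain ⟨⟨z₁, z₂⟩, hz⟩ := hne
  have m₁ := mem_dir_of_dir_union_eq_univ hu₁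
  have m₁' := mem_dir_of_dir_union_eq_univ (union_comm _ _ ▸ hu₁)
  have m₂ := mem_dir_of_dir_union_eq_univ hu₂
  have m₂' := mem_dir_of_dir_union_eq_univ (union_comm _ _ ▸ hu₂)
  have hcore := smul_mem_core hT₁ hT₂ hiso₁ hiso₂ hz
  have k : ∀ g : G, g • z₁ ∈ dir x₁ y₁ → g • z₂ ∉ dir x₂ y₂ := fun g h1 h2 =>
    hl (heavy_of_mem_core hT₁ hT₂ (hcore g) h1 h2)
  have k' : ∀ g : G, g • z₁ ∈ dir x₁' y₁' → g • z₂ ∉ dir x₂' y₂' := fun g h1 h2 =>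
    hl' (heavy_of_mem_core hT₁ hT₂ (hcore g) h1 h2)
  have c₁ : ∀ p, p ∉ dir x₁ y₁ → p ∈ dir x₁' y₁' := fun p =>
    (hu₁ ▸ mem_univ p : p ∈ dir x₁ y₁ ∪ dir x₁' y₁').resolve_left
  have c₂ : ∀ p, p ∉ dir x₂ y₂ → p ∈ dir x₂' y₂' := fun p =>
    (hu₂ ▸ mem_univ p : p ∈ dir x₂ y₂ ∪ dir x₂' y₂').resolve_left
  refine ⟨{g | g • z₁ ∈ dir x₁ y₁}, z₁, x₁', x₁, z₂, x₂, x₂',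
    ⟨ne_of_mem_dir m₁, fun g hg => ?_, fun g hg => ?_⟩,
    ⟨ne_of_mem_dir m₂', fun g hg => ?_, fun g hg => ?_⟩⟩
  · exact mem_seg_of_notMem_dir hT₁ m₁' fun h1 => k' g h1 (c₂ _ (k g hg))
  · exact mem_seg_of_notMem_dir hT₁ m₁ hg
  · exact mem_seg_of_notMem_dir hT₂ m₂ (k g hg)
  · exact mem_seg_of_notMem_dir hT₂ m₂' (k' g (c₁ _ hg))

end Facing

/-- Proposition 5.4: under dense minimal subtrees and non-empty core,
the core is disconnected iff `T₁` and `T₂` are refinements of a common non-trivial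
simplicial action of `G`. -/
theorem core_disconnected_iff_common_simplicial_refinement
    {G : Type} {T₁ T₂ : Type} [Group G] [MetricSpace T₁] [MetricSpace T₂]
    [MulAction G T₁] [MulAction G T₂]
    (hT₁ : IsRTree T₁) (hT₂ : IsRTree T₂)
    (hiso₁ : IsometricAction G T₁) (hiso₂ : IsometricAction G T₂)
    (hnt₁ : NontrivialAction G T₁) (hnt₂ : NontrivialAction G T₂)
    (hdense₁ : Dense (minSubtree G T₁)) (hdense₂ : Dense (minSubtree G T₂))
    (hne : (Core G T₁ T₂).Nonempty) :
    ¬ IsConnected (Core G T₁ T₂) ↔ RefineCommonSimplicial G T₁ T₂ := by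
  have h₁ := hT₁.treeLike
  have h₂ := hT₂.treeLike
  constructor
  · intro hcon
    have hfac : HasFacingLightQuadrants G T₁ T₂ := by
      by_contra hno
      exact hcon ⟨hne, isPreconnected_core h₁ h₂ hiso₁ hiso₂ hnt₁ hnt₂ hdense₁ hno⟩
    obtain ⟨H, z₁, a₁, b₁, z₂, a₂, b₂, c₁, c₂⟩ := hfac.exists_cutPair h₁ h₂ hiso₁ hiso₂ hne
    exact refineCommonSimplicial_of_cutPair h₁ h₂ hiso₁ hiso₂ hdense₁ hdense₂ c₁ c₂
  · exact not_isConnected_core_of_refineCommonSimplicial h₁ h₂ hiso₁ hnt₁ hdense₁ hiso₂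

end Guirardel
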